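/- arXiv:1009.5738 — 11 statements merged into one kernel-verified Lean document; each statement's English description precedes it below -/
import Mathlib

section
/- Let R be a partially ordered ring and let s ∈ R. Set S⁺(s) = {r ∈ R⁺ : 0 ≤ r·s} and let J = ⟨s·S⁺(s)⟩ be the order ideal generated by the set {s·r : r ∈ S⁺(s)} (a subset of R⁺). If there exist p ∈ R⁺ and q ∈ J with s = p + q (that is, the image of s in R/J is positive for the quotient ordering), then s ∈ R⁺. -/
/-- The order ideal generated by a subset `T` of the positive cone. -/
def orderIdealGen {R : Type*} [CommRing R] [PartialOrder R] (T : Set R) : Set R :=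
  {r | ∃ (M : ℕ) (s : Finset R), 0 < M ∧ ↑s ⊆ T ∧
    -(M • ∑ t ∈ s, t) ≤ r ∧ r ≤ M • ∑ t ∈ s, t}

/-- If `a * s` and `s + a * s` are nonnegative, where `0 ≤ a ≤ M`, then `s` is nonnegative.
Multiplying `M * s + j * (a * s) ≥ 0` by `M - a` lowers `j` by one. -/
theorem nonneg_of_nonneg_mul_of_nonneg_add_mul {R : Type*} [CommRing R] [PartialOrder R]
    [IsOrderedAddMonoid R]
    (hmulpos : ∀ a b : R, 0 ≤ a → 0 ≤ b → 0 ≤ a * b)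
    (hunperf : ∀ (k : ℕ) (g : R), 0 < k → 0 ≤ k • g → 0 ≤ g)
    {a s : R} {M : ℕ} (hM : 0 < M) (ha : 0 ≤ a) (haM : a ≤ M • (1 : R))
    (has : 0 ≤ a * s) (hs : 0 ≤ s + a * s) : 0 ≤ s := by
  have step (j : ℕ) (h : 0 ≤ M • s + (j + 1) • (a * s)) : 0 ≤ M • s + j • (a * s) := by
    refine hunperf M _ hM ?_
    have h₁ := hmulpos _ _ (sub_nonneg.2 haM) h
    have h₂ := nsmul_nonneg (hmulpos _ _ ha has) (j + 1)
    convert add_nonneg h₁ h₂ using 1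
    simp only [nsmul_eq_mul]
    push_cast
    ring
  have descent (j : ℕ) : 0 ≤ M • s + j • (a * s) → 0 ≤ M • s := by
    induction j with
    | zero => simp
    | succ j ih => exact fun h => ih (step j h)
  refine hunperf M s hM (descent M ?_)
  rw [← nsmul_add]
  exact nsmul_nonneg hs M

/-- A finite sum of elements of `s·S⁺(s)` lies in `s·S⁺(s)`. -/
theorem sum_mem_image_mul_left {R : Type*} [CommRing R] [PartialOrder R]
    [IsOrderedAddMonoid R] (s : R) (F : Finset R)
    (hF : ↑F ⊆ (fun r => s * r) '' {r : R | 0 ≤ r ∧ 0 ≤ r * s}) :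
    ∑ t ∈ F, t ∈ (fun r => s * r) '' {r : R | 0 ≤ r ∧ 0 ≤ r * s} := by
  refine Finset.sum_induction _ _ ?_ ⟨0, by simp⟩ fun t ht => hF ht
  rintro _ _ ⟨r, ⟨hr, hrs⟩, rfl⟩ ⟨r', ⟨hr', hrs'⟩, rfl⟩
  exact ⟨r + r', ⟨add_nonneg hr hr', by rw [add_mul]; exact add_nonneg hrs hrs'⟩,
    mul_add s r r'⟩

/-- if `s = p + q` with `p ≥ 0` and `q` in the order ideal generated by
`s·S⁺(s)` (where `S⁺(s) = {r ∈ R⁺ : 0 ≤ r·s}`), then `s ≥ 0`. -/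
theorem pos_of_posMod_orderIdealGen_smul
    (R : Type*) [CommRing R] [PartialOrder R]
    (hadd : ∀ a b c : R, a ≤ b → a + c ≤ b + c)
    (hmulpos : ∀ a b : R, 0 ≤ a → 0 ≤ b → 0 ≤ a * b)
    (hunperf : ∀ (k : ℕ) (g : R), 0 < k → 0 ≤ k • g → 0 ≤ g)
    (honeunit : ∀ g : R, ∃ M : ℕ, 0 < M ∧ -(M • (1 : R)) ≤ g ∧ g ≤ M • (1 : R))
    (s : R)
    (hyp : ∃ p q : R, 0 ≤ p ∧
      q ∈ orderIdealGen ((fun r => s * r) '' {r : R | 0 ≤ r ∧ 0 ≤ r * s}) ∧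
      s = p + q) :
    0 ≤ s := by
  have : IsOrderedAddMonoid R :=
    { add_le_add_left := fun a b h c => hadd a b c h }
  obtain ⟨p, q, hp, ⟨M, F, -, hF, hq, -⟩, hs⟩ := hyp
  obtain ⟨r, ⟨hr, hrs⟩, hsum⟩ := sum_mem_image_mul_left s F hF
  obtain ⟨N, hN, -, hrN⟩ := honeunit (M • r)
  refine nonneg_of_nonneg_mul_of_nonneg_add_mul hmulpos hunperf hN (nsmul_nonneg hr M) hrN ?_ ?_
  · rw [smul_mul_assoc]
    exact nsmul_nonneg hrs M
  · rw [← hsum, neg_le_iff_add_nonneg] at hq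
    convert add_nonneg hp hq using 1
    rw [smul_mul_assoc, mul_comm r s, ← add_assoc, ← hs]
end

section
/- Let R = ℝ[x] be the real polynomial ring in one variable, equipped with the positive cone R₂⁺ = {0} ∪ {x^j·f : j = 0 or j ≥ 2, and f is a polynomial with f(t) > 0 for all t ∈ [0,1]}. Then R with this cone satisfies order unit cancellation: if u is an order unit for this ordering (for every g ∈ R there is a positive integer M with M·u - g ∈ R₂⁺ and M·u + g ∈ R₂⁺), u ≠ 0, and a ∈ R satisfies u·a ∈ R₂⁺, then a ∈ R₂⁺. -/
/-- The positive cone `R₂⁺` on `ℝ[x]`: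
`{0} ∪ {x^j·f : j = 0 or j ≥ 2, f > 0 on [0,1]}`. -/
def pos2 : Set (Polynomial ℝ) :=
  {0} ∪ {g | ∃ (j : ℕ) (f : Polynomial ℝ), (j = 0 ∨ 2 ≤ j) ∧
    (∀ t ∈ Set.Icc (0 : ℝ) 1, 0 < f.eval t) ∧ g = Polynomial.X ^ j * f}

theorem eval_nonneg_of_mem_pos2 {g : Polynomial ℝ} (hg : g ∈ pos2) {t : ℝ}
    (ht : t ∈ Set.Icc (0 : ℝ) 1) : 0 ≤ g.eval t := by
  rcases hg with rfl | ⟨j, f, -, hf, rfl⟩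
  · simp
  · simpa using mul_nonneg (pow_nonneg ht.1 j) (hf t ht).le

theorem eval_pos_of_orderUnit_pos2 {u : Polynomial ℝ} {M : ℕ} (hu : M • u - 1 ∈ pos2) {t : ℝ}
    (ht : t ∈ Set.Icc (0 : ℝ) 1) : 0 < u.eval t := by
  have h : (1 : ℝ) ≤ M * u.eval t := by
    simpa [nsmul_eq_mul] using eval_nonneg_of_mem_pos2 hu ht
  exact pos_of_mul_pos_right (one_pos.trans_le h) M.cast_nonneg

/-- `(ℝ[x], R₂⁺)` satisfies order unit cancellation. -/
theorem pos2_orderUnitCancellation :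
    ∀ u a : Polynomial ℝ,
      (∀ g : Polynomial ℝ, ∃ M : ℕ, 0 < M ∧ M • u - g ∈ pos2 ∧ M • u + g ∈ pos2) →
      u ≠ 0 → u * a ∈ pos2 → a ∈ pos2 := by
  intro u a hunit hu0 hua
  obtain ⟨M, -, hM, -⟩ := hunit 1
  have hu : ∀ t ∈ Set.Icc (0 : ℝ) 1, 0 < u.eval t := fun t ht => eval_pos_of_orderUnit_pos2 hM ht
  rcases hua with h | ⟨j, f, hj, hf, h⟩
  · exact Or.inl ((mul_eq_zero.mp h).resolve_left hu0)
  · have hX : ¬ Polynomial.X ∣ u := by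
      rw [Polynomial.X_dvd_iff, Polynomial.coeff_zero_eq_eval_zero]
      exact (hu 0 (by simp)).ne'
    obtain ⟨b, rfl⟩ : Polynomial.X ^ j ∣ a :=
      Polynomial.prime_X.pow_dvd_of_dvd_mul_left j hX ⟨f, h⟩
    have hub : u * b = f :=
      mul_left_cancel₀ (pow_ne_zero j Polynomial.X_ne_zero) (by rw [← h]; ring)
    refine Or.inr ⟨j, b, hj, fun t ht => ?_, rfl⟩
    have hft := hf t ht
    rw [← hub, Polynomial.eval_mul] at hft
    exact pos_of_mul_pos_right hft (hu t ht).le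
end

section
/- Let R be a partially ordered ring and I an order ideal of R. Define rad⁺ I to be the set of differences of elements of (rad I) ∩ R⁺, where rad I = {r ∈ R : r^n ∈ I for some positive integer n}. Then rad⁺ I is an order ideal of R, and I ⊆ rad⁺ I ⊆ rad I (so in particular the prime ideals minimal over I, over rad⁺ I, and over rad I coincide). -/
/-- An order ideal of a partially ordered ring: an additive subgroup that is
convex and directed. -/
def IsOrderIdeal {R : Type*} [CommRing R] [PartialOrder R] (I : AddSubgroup R) : Prop :=
  (∀ g h : R, 0 ≤ g → g ≤ h → h ∈ I → g ∈ I) ∧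
  (∀ i ∈ I, ∃ a b : R, a ∈ I ∧ 0 ≤ a ∧ b ∈ I ∧ 0 ≤ b ∧ i = a - b)

/-- The radical of an additive subgroup (as a set). -/
def radSet {R : Type*} [CommRing R] (I : AddSubgroup R) : Set R :=
  {r | ∃ m : ℕ, 0 < m ∧ r ^ m ∈ I}

/-- `rad⁺ I`: differences of positive elements of the radical of `I`. -/
def radPlusSet {R : Type*} [CommRing R] [PartialOrder R] (I : AddSubgroup R) : Set R :=
  {x | ∃ a b : R, a ∈ radSet I ∧ 0 ≤ a ∧ b ∈ radSet I ∧ 0 ≤ b ∧ x = a - b}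

/-- In a partially ordered ring in which `1` is an order unit, order ideals are ideals. -/
theorem IsOrderIdeal.mul_mem {R : Type*} [CommRing R] [PartialOrder R] [IsOrderedRing R]
    (honeunit : ∀ g : R, ∃ M : ℕ, 0 < M ∧ -(M • (1 : R)) ≤ g ∧ g ≤ M • (1 : R))
    {I : AddSubgroup R} (hI : IsOrderIdeal I) (r : R) {i : R} (hi : i ∈ I) : r * i ∈ I := by
  have key : ∀ a ∈ I, 0 ≤ a → r * a ∈ I := by
    intro a ha ha0
    obtain ⟨M, -, hM1, hM2⟩ := honeunit r
    have hMa : M • a ∈ I := I.nsmul_mem ha M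
    have h1 : -(M • a) ≤ r * a := by
      simpa using mul_le_mul_of_nonneg_right hM1 ha0
    have h2 : r * a ≤ M • a := by
      simpa using mul_le_mul_of_nonneg_right hM2 ha0
    have h3 : r * a + M • a ∈ I :=
      hI.1 _ (M • a + M • a) (neg_le_iff_add_nonneg.mp h1) (add_le_add_left h2 _)
        (I.add_mem hMa hMa)
    simpa using I.sub_mem h3 hMa
  obtain ⟨a, b, ha, ha0, hb, hb0, rfl⟩ := hI.2 i hi
  rw [mul_sub]
  exact I.sub_mem (key a ha ha0) (key b hb hb0)

/-- The radical of an additive subgroup closed under multiplication by ring elements is the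
radical of the corresponding ideal. -/
theorem radSet_eq_radical {R : Type*} [CommRing R] {I : AddSubgroup R} {K : Ideal R}
    (hK : ∀ x, x ∈ K ↔ x ∈ I) : radSet I = (K.radical : Set R) := by
  ext r
  constructor
  · rintro ⟨m, -, hm⟩
    exact ⟨m, (hK _).2 hm⟩
  · rintro ⟨m, hm⟩
    refine ⟨m + 1, m.succ_pos, (hK _).1 ?_⟩
    rw [pow_succ]
    exact K.mul_mem_right r hm

/-- Nonnegative elements below an element of the radical of an order ideal are in the radical. -/
theorem IsOrderIdeal.mem_radSet_of_le {R : Type*} [CommRing R] [PartialOrder R]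
    [IsOrderedRing R] {I : AddSubgroup R} (hI : IsOrderIdeal I) {g a : R} (hg : 0 ≤ g)
    (hga : g ≤ a) (ha : a ∈ radSet I) : g ∈ radSet I := by
  obtain ⟨m, hm, ham⟩ := ha
  exact ⟨m, hm, hI.1 _ _ (pow_nonneg hg m) (pow_le_pow_left₀ hg hga m) ham⟩

/-- `rad⁺ I` is an order ideal and `I ⊆ rad⁺ I ⊆ rad I`. -/
theorem radPlus_isOrderIdeal_and_between
    (R : Type*) [CommRing R] [PartialOrder R]
    (hadd : ∀ a b c : R, a ≤ b → a + c ≤ b + c)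
    (hmulpos : ∀ a b : R, 0 ≤ a → 0 ≤ b → 0 ≤ a * b)
    (hunperf : ∀ (k : ℕ) (g : R), 0 < k → 0 ≤ k • g → 0 ≤ g)
    (honeunit : ∀ g : R, ∃ M : ℕ, 0 < M ∧ -(M • (1 : R)) ≤ g ∧ g ≤ M • (1 : R))
    (I : AddSubgroup R) (hI : IsOrderIdeal I) :
    (∃ J : AddSubgroup R, (J : Set R) = radPlusSet I ∧ IsOrderIdeal J) ∧
    (I : Set R) ⊆ radPlusSet I ∧ radPlusSet I ⊆ radSet I := by
  have : IsOrderedAddMonoid R :=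
    { add_le_add_left := fun a b h c => hadd a b c h }
  have hone : (0 : R) ≤ 1 := by
    obtain ⟨M, hM, h1, h2⟩ := honeunit 0
    exact hunperf M 1 hM h2
  have : ZeroLEOneClass R := ⟨hone⟩
  have : IsOrderedRing R := .of_mul_nonneg hmulpos
  let K : Ideal R :=
    { I with smul_mem' := fun r _ hi => hI.mul_mem honeunit r hi }
  have hrad : radSet I = (K.radical : Set R) := radSet_eq_radical fun _ => Iff.rfl
  have hzero : (0 : R) ∈ radSet I := hrad ▸ K.radical.zero_mem
  have hadd_mem : ∀ {a b : R}, a ∈ radSet I → b ∈ radSet I → a + b ∈ radSet I := by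
    rw [hrad]
    exact K.radical.add_mem
  have hself : ∀ {a : R}, a ∈ I → a ∈ radSet I := fun ha => ⟨1, one_pos, by simpa using ha⟩
  refine ⟨⟨{ carrier := radPlusSet I, zero_mem' := ?_, add_mem' := ?_, neg_mem' := ?_ },
    rfl, ?_, ?_⟩, ?_, ?_⟩
  · rintro _ _ ⟨a, b, ha, ha0, hb, hb0, rfl⟩ ⟨c, d, hc, hc0, hd, hd0, rfl⟩
    exact ⟨a + c, b + d, hadd_mem ha hc, add_nonneg ha0 hc0, hadd_mem hb hd,
      add_nonneg hb0 hd0, by ring⟩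
  · exact ⟨0, 0, hzero, le_rfl, hzero, le_rfl, by simp⟩
  · rintro _ ⟨a, b, ha, ha0, hb, hb0, rfl⟩
    exact ⟨b, a, hb, hb0, ha, ha0, by ring⟩
  · rintro g _ hg hgh ⟨a, b, ha, ha0, hb, hb0, rfl⟩
    exact ⟨g, 0, hI.mem_radSet_of_le hg (hgh.trans (sub_le_self a hb0)) ha, hg, hzero, le_rfl,
      by simp⟩
  · rintro _ ⟨a, b, ha, ha0, hb, hb0, rfl⟩
    exact ⟨a, b, ⟨a, 0, ha, ha0, hzero, le_rfl, by simp⟩, ha0,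
      ⟨b, 0, hb, hb0, hzero, le_rfl, by simp⟩, hb0, rfl⟩
  · intro i hi
    obtain ⟨a, b, ha, ha0, hb, hb0, rfl⟩ := hI.2 i hi
    exact ⟨a, b, hself ha, ha0, hself hb, hb0, rfl⟩
  · rintro _ ⟨a, b, ha, -, hb, -, rfl⟩
    rw [hrad] at ha hb ⊢
    exact K.radical.sub_mem ha hb
end

section
/- Let R be a partially ordered ring and let J be an order ideal of R that, as an ideal, is generated by a finite set {a₁,…,a_k} of elements of R⁺. Then a₁ + ⋯ + a_k is an order unit of J: for every j ∈ J there is a positive integer M with -M·(a₁+⋯+a_k) ≤ j ≤ M·(a₁+⋯+a_k). -/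
/-- if an order ideal `J` is generated as an ideal by finitely many
positive elements `a₁, …, a_k`, then `a₁ + ⋯ + a_k` is an order unit of `J`. -/
theorem sum_generators_isOrderUnit_of_orderIdeal
    (R : Type*) [CommRing R] [PartialOrder R]
    (hadd : ∀ a b c : R, a ≤ b → a + c ≤ b + c)
    (hmulpos : ∀ a b : R, 0 ≤ a → 0 ≤ b → 0 ≤ a * b)
    (hunperf : ∀ (k : ℕ) (g : R), 0 < k → 0 ≤ k • g → 0 ≤ g)
    (honeunit : ∀ g : R, ∃ M : ℕ, 0 < M ∧ -(M • (1 : R)) ≤ g ∧ g ≤ M • (1 : R))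
    (J : AddSubgroup R) (hJ : IsOrderIdeal J)
    (k : ℕ) (a : Fin k → R) (hapos : ∀ i, 0 ≤ a i)
    (hgen : (J : Set R) = ↑(Ideal.span (Set.range a))) :
    ∀ j ∈ J, ∃ M : ℕ, 0 < M ∧ -(M • ∑ i, a i) ≤ j ∧ j ≤ M • ∑ i, a i := by
  have : IsOrderedAddMonoid R :=
    { add_le_add_left := fun a b h c => hadd a b c h }
  intro j hj
  have hj' : j ∈ Ideal.span (Set.range a) := by
    rw [← SetLike.mem_coe, ← hgen]
    exact hj
  obtain ⟨c, rfl⟩ := Ideal.mem_span_range_iff_exists_fun.mp hj'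
  choose N _ hlo hhi using fun i => honeunit (c i)
  have hN (i : Fin k) : N i • a i ≤ (∑ i, N i + 1) • a i :=
    nsmul_le_nsmul_left (hapos i)
      ((Finset.single_le_sum (fun _ _ => Nat.zero_le _) (Finset.mem_univ i)).trans
        (Nat.le_succ _))
  refine ⟨∑ i, N i + 1, Nat.succ_pos _, ?_, ?_⟩
  · rw [Finset.smul_sum, ← Finset.sum_neg_distrib]
    refine Finset.sum_le_sum fun i _ => (neg_le_neg (hN i)).trans (sub_nonneg.mp ?_)
    have h := hmulpos _ _ (sub_nonneg.mpr (hlo i)) (hapos i)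
    rwa [sub_mul, neg_mul, smul_mul_assoc, one_mul] at h
  · rw [Finset.smul_sum]
    refine Finset.sum_le_sum fun i _ => (sub_nonneg.mp ?_).trans (hN i)
    have h := hmulpos _ _ (sub_nonneg.mpr (hhi i)) (hapos i)
    rwa [sub_mul, smul_mul_assoc, one_mul] at h
end

section
/- Let R be a partially ordered ring. Suppose that every proper order ideal J of R that is meet-irreducible as an order ideal (i.e., whenever J = J₁ ∩ J₂ with J₁, J₂ order ideals of R, then J = J₁ or J = J₂) is a primary ideal of R. Then R satisfies order unit cancellation: for every order unit u of R that is not a zero divisor and every a ∈ R, 0 ≤ u·a implies 0 ≤ a. -/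
section OrderIdeals

variable {R : Type*} [CommRing R] [PartialOrder R]

/-- The bounded elements relative to a nonnegative `x` form an order ideal containing `x`. -/
theorem exists_isOrderIdeal_forall_mem_iff [IsOrderedRing R] {x : R} (hx : 0 ≤ x) :
    ∃ J : AddSubgroup R, IsOrderIdeal J ∧
      ∀ r, r ∈ J ↔ ∃ K : ℕ, -(K • x) ≤ r ∧ r ≤ K • x := by
  let J : AddSubgroup R :=
    { carrier := {r | ∃ K : ℕ, -(K • x) ≤ r ∧ r ≤ K • x}
      zero_mem' := ⟨0, by simp⟩
      add_mem' := by
        rintro r s ⟨K, h₁, h₂⟩ ⟨L, h₃, h₄⟩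
        refine ⟨K + L, ?_, ?_⟩
        · rw [add_nsmul, neg_add]
          exact add_le_add h₁ h₃
        · rw [add_nsmul]
          exact add_le_add h₂ h₄
      neg_mem' := by
        rintro r ⟨K, h₁, h₂⟩
        exact ⟨K, neg_le_neg h₂, neg_le.mp h₁⟩ }
  have hmem : ∀ r, r ∈ J ↔ ∃ K : ℕ, -(K • x) ≤ r ∧ r ≤ K • x := fun r => Iff.rfl
  have hmul : ∀ K : ℕ, K • x ∈ J := fun K =>
    ⟨K, (neg_nonpos.mpr (nsmul_nonneg hx K)).trans (nsmul_nonneg hx K), le_rfl⟩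
  refine ⟨J, ⟨?_, ?_⟩, hmem⟩
  · intro g h hg hgh hh
    obtain ⟨K, -, hK⟩ := (hmem h).mp hh
    exact ⟨K, (neg_nonpos.mpr (nsmul_nonneg hx K)).trans hg, hgh.trans hK⟩
  · intro i hi
    obtain ⟨K, hK, -⟩ := (hmem i).mp hi
    exact ⟨i + K • x, K • x, J.add_mem hi (hmul K), neg_le_iff_add_nonneg.mp hK, hmul K,
      nsmul_nonneg hx K, (add_sub_cancel_right _ _).symm⟩

theorem isOrderIdeal_sSup_of_directedOn {c : Set (AddSubgroup R)} (hne : c.Nonempty)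
    (hdir : DirectedOn (· ≤ ·) c) (hc : ∀ I ∈ c, IsOrderIdeal I) : IsOrderIdeal (sSup c) := by
  refine ⟨?_, ?_⟩
  · intro g h hg hgh hh
    obtain ⟨I, hI, hhI⟩ := (AddSubgroup.mem_sSup_of_directedOn hne hdir).mp hh
    exact (le_sSup hI : I ≤ sSup c) ((hc I hI).1 g h hg hgh hhI)
  · intro i hi
    obtain ⟨I, hI, hiI⟩ := (AddSubgroup.mem_sSup_of_directedOn hne hdir).mp hi
    obtain ⟨a, b, ha, ha0, hb, hb0, hab⟩ := (hc I hI).2 i hiI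
    exact ⟨a, b, (le_sSup hI : I ≤ sSup c) ha, ha0, (le_sSup hI : I ≤ sSup c) hb, hb0, hab⟩

/-- An order ideal avoiding `a` is contained in a meet-irreducible order ideal avoiding `a`. -/
theorem IsOrderIdeal.exists_le_meetIrreducible_notMem {J : AddSubgroup R} (hJ : IsOrderIdeal J)
    {a : R} (ha : a ∉ J) :
    ∃ I : AddSubgroup R, J ≤ I ∧ IsOrderIdeal I ∧ a ∉ I ∧
      ∀ J₁ J₂ : AddSubgroup R, IsOrderIdeal J₁ → IsOrderIdeal J₂ →
        I = J₁ ⊓ J₂ → I = J₁ ∨ I = J₂ := by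
  obtain ⟨I, hJI, hI⟩ := zorn_le_nonempty₀ {I : AddSubgroup R | IsOrderIdeal I ∧ a ∉ I}
    (fun c hcs hc y hy => by
      refine ⟨sSup c, ⟨isOrderIdeal_sSup_of_directedOn ⟨y, hy⟩ hc.directedOn
        fun I hI => (hcs hI).1, fun h => ?_⟩, fun z hz => le_sSup hz⟩
      obtain ⟨I, hI, haI⟩ := (AddSubgroup.mem_sSup_of_directedOn ⟨y, hy⟩ hc.directedOn).mp h
      exact (hcs hI).2 haI) J ⟨hJ, ha⟩
  refine ⟨I, hJI, hI.prop.1, hI.prop.2, fun J₁ J₂ h₁ h₂ h => ?_⟩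
  have hle₁ : I ≤ J₁ := h.le.trans inf_le_left
  have hle₂ : I ≤ J₂ := h.le.trans inf_le_right
  by_cases ha₁ : a ∈ J₁
  · by_cases ha₂ : a ∈ J₂
    · exact absurd (h ▸ AddSubgroup.mem_inf.mpr ⟨ha₁, ha₂⟩) hI.prop.2
    · exact Or.inr (hI.eq_of_le ⟨h₂, ha₂⟩ hle₂)
  · exact Or.inl (hI.eq_of_le ⟨h₁, ha₁⟩ hle₁)

/-- An order ideal containing a power of an order unit is everything. -/
theorem IsOrderIdeal.mem_of_pow_mem [IsOrderedRing R] {I : AddSubgroup R} (hI : IsOrderIdeal I)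
    (hone : ∀ g : R, ∃ M : ℕ, -(M • (1 : R)) ≤ g ∧ g ≤ M • (1 : R)) {u : R} {M m : ℕ}
    (hu : 1 ≤ M • u) (hm : u ^ m ∈ I) (g : R) : g ∈ I := by
  have h1 : (1 : R) ∈ I := by
    refine hI.1 1 (M ^ m • u ^ m) zero_le_one ?_ (I.nsmul_mem hm _)
    rw [← smul_pow]
    exact one_le_pow₀ hu
  obtain ⟨N, hN₁, hN₂⟩ := hone g
  have hN : N • (1 : R) ∈ I := I.nsmul_mem h1 N
  have : g + N • 1 ∈ I := hI.1 _ (N • 1 + N • 1) (neg_le_iff_add_nonneg.mp hN₁)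
    (add_le_add_left hN₂ _) (I.add_mem hN hN)
  simpa using I.sub_mem this hN

/-- In an unperforated ordered ring, a nonnegative element `u` bounded by a multiple of `1` can be
cancelled from `0 ≤ u * a` as soon as `a` is bounded below by a multiple of `u * a`. -/
theorem nonneg_of_mul_nonneg_of_neg_nsmul_le [IsOrderedRing R]
    (hunperf : ∀ (k : ℕ) (g : R), 0 < k → 0 ≤ k • g → 0 ≤ g) {u a : R} {N K : ℕ}
    (hN : 0 < N) (hu : 0 ≤ u) (huN : u ≤ N • (1 : R)) (hua : 0 ≤ u * a)
    (hK : -(K • (u * a)) ≤ a) : 0 ≤ a := by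
  have hdown : ∀ j : ℕ, 0 ≤ (N + j * u) * a → 0 ≤ (N : R) * a := by
    intro j
    induction j with
    | zero => simp
    | succ j ih =>
      intro h
      refine ih (hunperf N _ hN ?_)
      have h₁ : 0 ≤ ((N : R) - u) * ((N + (j + 1 : ℕ) * u) * a) :=
        mul_nonneg (sub_nonneg.mpr (by simpa using huN)) h
      have h₂ : 0 ≤ ((j + 1 : ℕ) : R) * (u * (u * a)) :=
        mul_nonneg (Nat.cast_nonneg _) (mul_nonneg hu hua)
      convert add_nonneg h₁ h₂ using 1
      rw [nsmul_eq_mul]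
      push_cast
      ring
  refine hunperf N a hN ?_
  rw [nsmul_eq_mul]
  refine hdown (N * K) ?_
  have h : 0 ≤ (N : R) * (a + K • (u * a)) :=
    mul_nonneg (Nat.cast_nonneg _) (neg_le_iff_add_nonneg.mp hK)
  convert h using 1
  rw [nsmul_eq_mul]
  push_cast
  ring

end OrderIdeals

/-- if every proper order ideal that is meet-irreducible as an order
ideal is primary as an ideal, then the ring satisfies order unit cancellation. -/
theorem orderUnitCancellation_of_meetIrreducible_primary
    (R : Type*) [CommRing R] [PartialOrder R]
    (hadd : ∀ a b c : R, a ≤ b → a + c ≤ b + c)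
    (hmulpos : ∀ a b : R, 0 ≤ a → 0 ≤ b → 0 ≤ a * b)
    (hunperf : ∀ (k : ℕ) (g : R), 0 < k → 0 ≤ k • g → 0 ≤ g)
    (honeunit : ∀ g : R, ∃ M : ℕ, 0 < M ∧ -(M • (1 : R)) ≤ g ∧ g ≤ M • (1 : R))
    (hprimary : ∀ J : AddSubgroup R, IsOrderIdeal J → (J : Set R) ≠ Set.univ →
      (∀ J₁ J₂ : AddSubgroup R, IsOrderIdeal J₁ → IsOrderIdeal J₂ →
        J = J₁ ⊓ J₂ → J = J₁ ∨ J = J₂) →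
      (∀ a b : R, a * b ∈ J → a ∉ J → ∃ m : ℕ, 0 < m ∧ b ^ m ∈ J)) :
    ∀ u a : R, (∀ g : R, ∃ M : ℕ, 0 < M ∧ -(M • u) ≤ g ∧ g ≤ M • u) →
      (∀ r : R, u * r = 0 → r = 0) → 0 ≤ u * a → 0 ≤ a := by
  intro u a hu _ hua
  have : IsOrderedAddMonoid R :=
    { add_le_add_left := fun a b h c => hadd a b c h }
  have hnonneg : ∀ v : R, (∃ M : ℕ, 0 < M ∧ -(M • v) ≤ v ∧ v ≤ M • v) → 0 ≤ v := by
    rintro v ⟨M, -, hM, -⟩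
    refine hunperf (M + 1) v M.succ_pos ?_
    rw [succ_nsmul']
    exact neg_le_iff_add_nonneg.mp hM
  have : ZeroLEOneClass R := ⟨hnonneg 1 (honeunit 1)⟩
  have : IsOrderedRing R := .of_mul_nonneg hmulpos
  obtain ⟨J, hJ, hmem⟩ := exists_isOrderIdeal_forall_mem_iff hua
  have haJ : a ∈ J := by
    by_contra ha
    obtain ⟨I, hJI, hI, haI, hirr⟩ := hJ.exists_le_meetIrreducible_notMem ha
    have huaI : a * u ∈ I := by
      rw [mul_comm]
      refine hJI ((hmem _).mpr ⟨1, ?_, ?_⟩)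
      · rw [one_nsmul]
        exact (neg_nonpos.mpr hua).trans hua
      · rw [one_nsmul]
    obtain ⟨m, -, hm⟩ := hprimary I hI (fun h => haI (h ▸ Set.mem_univ a : a ∈ (I : Set R)))
      hirr a u huaI haI
    obtain ⟨M, -, -, hM⟩ := hu 1
    exact haI (hI.mem_of_pow_mem (fun g => (honeunit g).imp fun _ h => h.2) hM hm a)
  obtain ⟨K, hK, -⟩ := (hmem a).mp haJ
  obtain ⟨N, hN, -, huN⟩ := honeunit u
  exact nonneg_of_mul_nonneg_of_neg_nsmul_le hunperf hN (hnonneg u (hu u)) huN hua hK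
end

section
/- Let R be a partially ordered ring and let X(R) be the set of ring homomorphisms φ : R → ℝ with φ(r) ≥ 0 for all r ∈ R⁺, topologized as a subspace of the product space ℝ^R (point-open topology). Let s ∈ R, S(s) = {r ∈ R : 0 ≤ r·s}, and let ⟨s·S(s)⟩ be the order ideal generated by the set {s·r : r ∈ S(s), 0 ≤ s·r} ⊆ R⁺. Suppose: (a) X(R) is connected and nonempty, and {φ ∈ X(R) : φ(s) = 0} is nowhere dense in X(R); (b) the ideal of R generated by ⟨s·S(s)⟩ ∪ S(s) is all of R. Then s ∈ R⁺ or -s ∈ R⁺. -/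
/-- The pure trace space: positive ring homomorphisms `R → ℝ`, viewed as a subset
of the product space `ℝ^R` (point-open topology). -/
def traceSpace (R : Type*) [CommRing R] [PartialOrder R] : Set (R → ℝ) :=
  {f | ∃ φ : R →+* ℝ, ⇑φ = f ∧ ∀ r : R, 0 ≤ r → 0 ≤ f r}

/-- A subset of an ordered ring that contains the positive cone, and is closed under addition and
under multiplication by nonnegative elements. -/
structure IsPosModule {R : Type*} [CommRing R] [PartialOrder R] (M : Set R) : Prop where
  of_nonneg : ∀ a, 0 ≤ a → a ∈ M
  add_mem : ∀ a ∈ M, ∀ b ∈ M, a + b ∈ M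
  mul_mem : ∀ a, 0 ≤ a → ∀ b ∈ M, a * b ∈ M

theorem IsPosModule.exists_maximal {R : Type*} [CommRing R] [PartialOrder R] {M : Set R}
    (hM : IsPosModule M) (h1 : (-1 : R) ∉ M) :
    ∃ N, M ⊆ N ∧ Maximal (fun N : Set R => IsPosModule N ∧ (-1 : R) ∉ N) N := by
  refine zorn_subset_nonempty {N : Set R | IsPosModule N ∧ (-1 : R) ∉ N} ?_ M ⟨hM, h1⟩
  intro c hc hchain hne
  refine ⟨⋃₀ c, ⟨⟨?_, ?_, ?_⟩, ?_⟩, fun s hs => Set.subset_sUnion_of_mem hs⟩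
  · obtain ⟨N, hN⟩ := hne
    exact fun a ha => ⟨N, hN, (hc hN).1.of_nonneg a ha⟩
  · rintro a ⟨N, hN, haN⟩ b ⟨N', hN', hbN'⟩
    rcases hchain.total hN hN' with h | h
    · exact ⟨N', hN', (hc hN').1.add_mem a (h haN) b hbN'⟩
    · exact ⟨N, hN, (hc hN).1.add_mem a haN b (h hbN')⟩
  · rintro a ha b ⟨N, hN, hbN⟩
    exact ⟨N, hN, (hc hN).1.mul_mem a ha b hbN⟩
  · rintro ⟨N, hN, h⟩
    exact (hc hN).2 h

section OrderedRing

variable {R : Type*} [CommRing R] [PartialOrder R] [IsOrderedRing R]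

theorem IsPosModule.adjoin {M : Set R} (hM : IsPosModule M) (a : R) :
    IsPosModule {x | ∃ m ∈ M, ∃ t, 0 ≤ t ∧ x = m + t * a} where
  of_nonneg x hx := ⟨x, hM.of_nonneg x hx, 0, le_rfl, by ring⟩
  add_mem := by
    rintro _ ⟨m, hm, t, ht, rfl⟩ _ ⟨m', hm', t', ht', rfl⟩
    exact ⟨m + m', hM.add_mem _ hm _ hm', t + t', add_nonneg ht ht', by ring⟩
  mul_mem := by
    rintro c hc _ ⟨m, hm, t, ht, rfl⟩
    exact ⟨c * m, hM.mul_mem c hc m hm, c * t, mul_nonneg hc ht, by ring⟩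

theorem IsPosModule.mem_or_neg_mem_of_maximal (hbdd : ∀ g : R, ∃ n : ℕ, g ≤ n) {M : Set R}
    (hM : Maximal (fun N : Set R => IsPosModule N ∧ (-1 : R) ∉ N) M) (a : R) :
    a ∈ M ∨ -a ∈ M := by
  have hc := hM.prop.1
  have key : ∀ b : R, b ∉ M → ∃ m ∈ M, ∃ t, 0 ≤ t ∧ (-1 : R) = m + t * b := by
    intro b hb
    by_contra h
    have hsub : M ⊆ {x | ∃ m ∈ M, ∃ t, 0 ≤ t ∧ x = m + t * b} :=
      fun x hx => ⟨x, hx, 0, le_rfl, by ring⟩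
    exact hb (hM.le_of_ge ⟨hc.adjoin b, h⟩ hsub
      ⟨0, hc.of_nonneg 0 le_rfl, 1, zero_le_one, by ring⟩)
  by_contra! h
  obtain ⟨m₁, hm₁, t₁, ht₁, e₁⟩ := key a h.1
  obtain ⟨m₂, hm₂, t₂, ht₂, e₂⟩ := key (-a) h.2
  have hneg : -t₁ ∈ M := by
    have : -t₁ = (t₂ * m₁ + t₁ * m₂) + t₂ := by linear_combination t₂ * e₁ + t₁ * e₂
    rw [this]
    exact hc.add_mem _ (hc.add_mem _ (hc.mul_mem _ ht₂ _ hm₁) _ (hc.mul_mem _ ht₁ _ hm₂)) _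
      (hc.of_nonneg _ ht₂)
  obtain ⟨n, hn⟩ := hbdd (-a)
  have hpos : (0 : R) ≤ n + a := by linear_combination hn
  apply hM.prop.2
  have : (-1 : R) = m₁ + ((n : R) * (-t₁) + t₁ * (n + a)) := by linear_combination e₁
  rw [this]
  exact hc.add_mem _ hm₁ _ (hc.add_mem _ (hc.mul_mem _ n.cast_nonneg _ hneg) _
    (hc.of_nonneg _ (mul_nonneg ht₁ hpos)))

/-- A total proper positive module in a ring with order unit `1` defines Dedekind cuts. -/
theorem IsPosModule.exists_cut (hbdd : ∀ g : R, ∃ n : ℕ, g ≤ n) {M : Set R}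
    (hM : IsPosModule M) (h1 : (-1 : R) ∉ M) :
    ∃ φ : R → ℝ, ∀ (a : R) (p : ℤ) (q : ℕ), 0 < q →
      ((q * a - p ∈ M → (p / q : ℝ) ≤ φ a) ∧ (p - q * a ∈ M → φ a ≤ (p / q : ℝ))) := by
  have hcmp : ∀ (a : R) (p p' : ℤ) (q q' : ℕ), 0 < q → 0 < q' → q * a - p ∈ M →
      p' - q' * a ∈ M → (p / q : ℝ) ≤ p' / q' := by
    intro a p p' q q' hq hq' h h'
    rw [div_le_div_iff₀ (by positivity) (by positivity)]
    by_contra! hlt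
    have hlt : p' * q < p * q' := by exact_mod_cast hlt
    obtain ⟨k, hk⟩ := Int.le.dest (Int.add_one_le_iff.mpr hlt)
    have hk : ((p' : R) * q + 1 + k) = p * q' := by exact_mod_cast congrArg (Int.cast : ℤ → R) hk
    apply h1
    have : (-1 : R) = ((q' : R) * (q * a - p) + q * (p' - q' * a)) + k := by
      linear_combination -hk
    rw [this]
    exact hM.add_mem _ (hM.add_mem _ (hM.mul_mem _ (Nat.cast_nonneg _) _ h) _
      (hM.mul_mem _ (Nat.cast_nonneg _) _ h')) _ (hM.of_nonneg _ (Nat.cast_nonneg _))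
  let L : R → Set ℝ := fun a => {x | ∃ (p : ℤ) (q : ℕ), 0 < q ∧ q * a - p ∈ M ∧ x = p / q}
  have hne : ∀ a, (L a).Nonempty := by
    intro a
    obtain ⟨n, hn⟩ := hbdd (-a)
    refine ⟨_, -(n : ℤ), 1, one_pos, hM.of_nonneg _ ?_, rfl⟩
    push_cast
    linear_combination hn
  have hbd : ∀ a, BddAbove (L a) := by
    intro a
    obtain ⟨n, hn⟩ := hbdd a
    refine ⟨((n : ℤ) : ℝ) / (1 : ℕ), ?_⟩
    rintro _ ⟨p, q, hq, h, rfl⟩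
    refine hcmp a p n q 1 hq one_pos h (hM.of_nonneg _ ?_)
    push_cast
    linear_combination hn
  refine ⟨fun a => sSup (L a), fun a p q hq => ⟨fun h => ?_, fun h => ?_⟩⟩
  · exact le_csSup (hbd a) ⟨p, q, hq, h, rfl⟩
  · refine csSup_le (hne a) ?_
    rintro _ ⟨p', q', hq', h', rfl⟩
    exact hcmp a p' p q' q hq' hq h' h

theorem IsPosModule.exists_ringHom (hbdd : ∀ g : R, ∃ n : ℕ, g ≤ n) {M : Set R}
    (hM : IsPosModule M) (h1 : (-1 : R) ∉ M) (htot : ∀ a, a ∈ M ∨ -a ∈ M) :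
    ∃ φ : R →+* ℝ, ∀ a ∈ M, 0 ≤ φ a := by
  obtain ⟨φ, hφ⟩ := hM.exists_cut hbdd h1
  have hlt : ∀ (a : R) (x : ℝ), x < φ a → ∃ (p : ℤ) (q : ℕ), 0 < q ∧ x < p / q ∧
      q * a - p ∈ M := by
    intro a x hx
    obtain ⟨r, hxr, hr⟩ := exists_rat_btwn hx
    have hcast : ((r : ℚ) : ℝ) = (r.num : ℝ) / (r.den : ℝ) := Rat.cast_def r
    rw [hcast] at hxr hr
    refine ⟨r.num, r.den, r.den_pos, hxr, ?_⟩
    by_contra h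
    have h' := (htot (r.den * a - r.num)).resolve_left h
    rw [neg_sub] at h'
    exact absurd ((hφ a _ _ r.den_pos).2 h') (not_le.mpr hr)
  have hgt : ∀ (a : R) (x : ℝ), φ a < x → ∃ (p : ℤ) (q : ℕ), 0 < q ∧ (p / q : ℝ) < x ∧
      p - q * a ∈ M := by
    intro a x hx
    obtain ⟨r, hxr, hr⟩ := exists_rat_btwn hx
    have hcast : ((r : ℚ) : ℝ) = (r.num : ℝ) / (r.den : ℝ) := Rat.cast_def r
    rw [hcast] at hxr hr
    refine ⟨r.num, r.den, r.den_pos, hr, ?_⟩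
    by_contra h
    have h' := (htot (r.num - r.den * a)).resolve_left h
    rw [neg_sub] at h'
    exact absurd ((hφ a _ _ r.den_pos).1 h') (not_le.mpr hxr)
  have hnonneg : ∀ a ∈ M, 0 ≤ φ a := by
    intro a ha
    simpa using (hφ a 0 1 one_pos).1 (by simpa using ha)
  have hint : ∀ p : ℤ, φ p = p := by
    intro p
    have h0 : (0 : R) ∈ M := hM.of_nonneg 0 le_rfl
    exact le_antisymm (by simpa using (hφ p p 1 one_pos).2 (by simpa using h0))
      (by simpa using (hφ p p 1 one_pos).1 (by simpa using h0))
  have hzero : φ 0 = 0 := by simpa using hint 0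
  have hsuper : ∀ a b, φ a + φ b ≤ φ (a + b) := by
    intro a b
    by_contra! h
    set ε := (φ a + φ b - φ (a + b)) / 2 with hε
    obtain ⟨p, q, hq, hx, hm⟩ := hlt a (φ a - ε) (by linarith)
    obtain ⟨p', q', hq', hx', hm'⟩ := hlt b (φ b - ε) (by linarith)
    have := (hφ (a + b) (q' * p + q * p') (q * q') (Nat.mul_pos hq hq')).1 (by
      have e : ((q * q' : ℕ) : R) * (a + b) - ((q' * p + q * p' : ℤ) : R) =
          q' * (q * a - p) + q * (q' * b - p') := by
        push_cast
        ring
      rw [e]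
      exact hM.add_mem _ (hM.mul_mem _ (Nat.cast_nonneg _) _ hm) _
        (hM.mul_mem _ (Nat.cast_nonneg _) _ hm'))
    have e : (((q' * p + q * p' : ℤ) : ℝ) / ((q * q' : ℕ) : ℝ)) = p / q + p' / q' := by
      push_cast
      field_simp
    rw [e] at this
    linarith
  have hneg : ∀ a, φ (-a) = -φ a := by
    intro a
    refine le_antisymm ?_ ?_
    · have := hsuper a (-a)
      rw [add_neg_cancel, hzero] at this
      linarith
    · by_contra! h
      obtain ⟨p, q, hq, hx, hm⟩ := hgt a (-φ (-a)) (by linarith)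
      have := (hφ (-a) (-p) q hq).1 (by
        have e : (q : R) * (-a) - ((-p : ℤ) : R) = p - q * a := by
          push_cast
          ring
        rwa [e])
      push_cast at this
      rw [neg_div] at this
      linarith
  have hadd : ∀ a b, φ (a + b) = φ a + φ b := by
    intro a b
    refine le_antisymm ?_ (hsuper a b)
    have := hsuper (a + b) (-a)
    rw [hneg, show a + b + -a = b by ring] at this
    linarith
  let ψ : R →+ ℝ := AddMonoidHom.mk' φ hadd
  have hψ : ∀ a, ψ a = φ a := fun a => rfl
  have hle : ∀ t, 0 ≤ t → ∀ a, φ t * φ a ≤ φ (t * a) := by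
    intro t ht a
    have ht0 := hnonneg t (hM.of_nonneg t ht)
    have key : ∀ x < φ a, φ t * x ≤ φ (t * a) := by
      intro x hx
      obtain ⟨p, q, hq, hx, hm⟩ := hlt a x hx
      have h := hnonneg _ (hM.mul_mem t ht _ hm)
      have e : t * (q * a - p) = q • (t * a) - p • t := by
        simp only [nsmul_eq_mul, zsmul_eq_mul]
        ring
      rw [e, ← hψ, map_sub, map_nsmul, map_zsmul, hψ, hψ, nsmul_eq_mul, zsmul_eq_mul] at h
      have hq' : (0 : ℝ) < q := by exact_mod_cast hq
      have h2 : φ t * (p / q) ≤ φ (t * a) := by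
        rw [← mul_div_assoc, div_le_iff₀ hq']
        linarith
      exact (mul_le_mul_of_nonneg_left hx.le ht0).trans h2
    refine le_of_tendsto (f := fun x => φ t * x) (x := nhdsWithin (φ a) (Set.Iio (φ a))) ?_ ?_
    · exact ((continuous_const.mul continuous_id).tendsto _).mono_left nhdsWithin_le_nhds
    · filter_upwards [self_mem_nhdsWithin] with x hx using key x hx
  have hmulpos : ∀ t, 0 ≤ t → ∀ a, φ (t * a) = φ t * φ a := by
    intro t ht a
    refine le_antisymm ?_ (hle t ht a)
    have := hle t ht (-a)
    rw [hneg, mul_neg, mul_neg, hneg] at this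
    linarith
  have hmul : ∀ a b, φ (a * b) = φ a * φ b := by
    intro a b
    obtain ⟨n, hn⟩ := hbdd (-a)
    have hpos : (0 : R) ≤ a + n := by linear_combination hn
    have h1 := hmulpos _ hpos b
    have h2 := hmulpos (n : R) n.cast_nonneg b
    rw [add_mul, hadd, hadd, h2] at h1
    linarith
  exact ⟨{ ψ with
    map_one' := show φ 1 = 1 by simpa using hint 1
    map_mul' := hmul }, hnonneg⟩

/-- An element that is strictly positive at every positive real-valued homomorphism is positive. -/
theorem nonneg_of_forall_ringHom_pos
    (hunperf : ∀ (k : ℕ) (g : R), 0 < k → 0 ≤ k • g → 0 ≤ g)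
    (hbdd : ∀ g : R, ∃ n : ℕ, g ≤ n) {g : R}
    (hg : ∀ φ : R →+* ℝ, (∀ r, 0 ≤ r → 0 ≤ φ r) → 0 < φ g) : 0 ≤ g := by
  have hP : IsPosModule {x : R | 0 ≤ x} :=
    ⟨fun _ h => h, fun _ ha _ hb => add_nonneg ha hb, fun _ ha _ hb => mul_nonneg ha hb⟩
  have hmem : (-1 : R) ∈ {x | ∃ m ∈ {x : R | 0 ≤ x}, ∃ t, 0 ≤ t ∧ x = m + t * -g} := by
    by_contra h
    obtain ⟨N, hsub, hN⟩ := (hP.adjoin (-g)).exists_maximal h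
    obtain ⟨φ, hφ⟩ := hN.prop.1.exists_ringHom hbdd hN.prop.2
      (IsPosModule.mem_or_neg_mem_of_maximal hbdd hN)
    have h1 := hg φ fun r hr => hφ r (hN.prop.1.of_nonneg r hr)
    have h2 := hφ (-g) (hsub ⟨0, le_refl (0 : R), 1, zero_le_one, by ring⟩)
    rw [map_neg] at h2
    linarith
  obtain ⟨m, hm, u, hu, e⟩ := hmem
  have hm : 0 ≤ m := hm
  obtain ⟨n₀, hn₀⟩ := hbdd u
  obtain ⟨n, hn0, hn⟩ : ∃ n : ℕ, 0 < n ∧ u ≤ n :=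
    ⟨n₀ + 1, Nat.succ_pos _, hn₀.trans (Nat.mono_cast (Nat.le_succ n₀))⟩
  have step : ∀ j : ℕ, (0 : R) ≤ j + n * g → 0 ≤ n * g := by
    intro j
    induction j with
    | zero => simp
    | succ j ih =>
      intro h
      apply ih
      apply hunperf n _ hn0
      have h1 := mul_nonneg (sub_nonneg.mpr hn) h
      have h2 := mul_nonneg (Nat.cast_nonneg (α := R) n) hm
      have h3 := mul_nonneg (Nat.cast_nonneg (α := R) (j + 1)) hu
      have e' : n • ((j : R) + n * g) =
          (n - u) * (((j + 1 : ℕ) : R) + n * g) + n * m + ((j + 1 : ℕ) : R) * u := by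
        rw [nsmul_eq_mul]
        push_cast
        linear_combination (n : R) * e
      rw [e']
      exact add_nonneg (add_nonneg h1 h2) h3
  obtain ⟨k, hk⟩ := hbdd (-g)
  have hk' : (0 : R) ≤ k + g := by linear_combination hk
  apply hunperf n g hn0
  rw [nsmul_eq_mul]
  apply step (n * k)
  have e' : ((n * k : ℕ) : R) + n * g = n * (k + g) := by
    push_cast
    ring
  rw [e']
  exact mul_nonneg n.cast_nonneg hk'

theorem nonneg_mul_add_one_of_forall_ringHom_nonneg
    (hunperf : ∀ (k : ℕ) (g : R), 0 < k → 0 ≤ k • g → 0 ≤ g)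
    (hbdd : ∀ g : R, ∃ n : ℕ, g ≤ n) {g : R}
    (hg : ∀ φ : R →+* ℝ, (∀ r, 0 ≤ r → 0 ≤ φ r) → 0 ≤ φ g) (n : ℕ) : 0 ≤ n * g + 1 := by
  refine nonneg_of_forall_ringHom_pos hunperf hbdd fun φ hφ => ?_
  have h := hg φ hφ
  rw [map_add, map_mul, map_natCast, map_one]
  positivity

/-- If an unperforated cone stable under positive multipliers contains `t` and `1 + t`, with `t`
nonnegative up to infinitesimals, then it contains `1`. -/
theorem one_mem_of_one_add_mem (hbdd : ∀ g : R, ∃ n : ℕ, g ≤ n) {C : Set R}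
    (hadd : ∀ a ∈ C, ∀ b ∈ C, a + b ∈ C) (hmul : ∀ c, 0 ≤ c → ∀ a ∈ C, c * a ∈ C)
    (hunp : ∀ (k : ℕ) (a : R), 0 < k → (k : R) * a ∈ C → a ∈ C) {t : R}
    (ht0 : 0 ≤ 2 * t + 1) (ht : t ∈ C) (h1t : 1 + t ∈ C) : (1 : R) ∈ C := by
  obtain ⟨n, hn⟩ := hbdd t
  obtain ⟨T, hT0, hT⟩ : ∃ T : ℕ, 0 < T ∧ t ≤ T :=
    ⟨n + 1, Nat.succ_pos _, hn.trans (Nat.mono_cast (Nat.le_succ n))⟩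
  have key : ∀ j : ℕ, j ≤ 2 * T → ((2 * T : ℕ) : R) + j * t ∈ C → ((2 * T : ℕ) : R) ∈ C := by
    intro j
    induction j with
    | zero => simp
    | succ j ih =>
      intro hj h
      apply ih (by omega)
      apply hunp (2 * T) _ (by omega)
      obtain ⟨i, hi⟩ := Nat.le.dest hj
      have hi' : ((j : R) + 1 + i) = 2 * T := by exact_mod_cast congrArg (Nat.cast : ℕ → R) hi
      have h1 := hmul (2 * (T - t)) (mul_nonneg zero_le_two (sub_nonneg.mpr hT)) _ h
      have h2 := hmul (((j + 1 : ℕ) : R) * (2 * t + 1)) (mul_nonneg (Nat.cast_nonneg _) ht0) _ ht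
      have h3 := hmul (i : R) (Nat.cast_nonneg _) _ ht
      have e : ((2 * T : ℕ) : R) * (((2 * T : ℕ) : R) + j * t) =
          2 * (T - t) * (((2 * T : ℕ) : R) + (j + 1 : ℕ) * t) +
            ((j + 1 : ℕ) : R) * (2 * t + 1) * t + i * t := by
        push_cast
        linear_combination -t * hi'
      rw [e]
      exact hadd _ (hadd _ h1 _ h2) _ h3
  have h := key (2 * T) le_rfl (by
    have := hmul ((2 * T : ℕ) : R) (Nat.cast_nonneg _) _ h1t
    rwa [mul_add, mul_one] at this)
  exact hunp (2 * T) 1 (by omega) (by rwa [mul_one])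

theorem nonneg_of_span_eq_top
    (hunperf : ∀ (k : ℕ) (g : R), 0 < k → 0 ≤ k • g → 0 ≤ g)
    (hbdd : ∀ g : R, ∃ n : ℕ, g ≤ n) {s : R}
    (hs : ∀ φ : R →+* ℝ, (∀ r, 0 ≤ r → 0 ≤ φ r) → 0 ≤ φ s)
    (hS : ∀ r, 0 ≤ r * s → ∀ φ : R →+* ℝ, (∀ r, 0 ≤ r → 0 ≤ φ r) → 0 ≤ φ r)
    (hspan : Ideal.span
        (orderIdealGen {x : R | ∃ r : R, 0 ≤ r * s ∧ 0 ≤ s * r ∧ x = s * r} ∪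
          {r : R | 0 ≤ r * s}) = ⊤) : 0 ≤ s := by
  let W : Set R := {z | (∀ φ : R →+* ℝ, (∀ r, 0 ≤ r → 0 ≤ φ r) → 0 ≤ φ z) ∧
    ∃ t, 0 ≤ t * s ∧ ∀ n : ℕ, 0 ≤ (n * z + t) * s}
  have Wadd : ∀ a ∈ W, ∀ b ∈ W, a + b ∈ W := by
    rintro a ⟨ha, t, ht, hat⟩ b ⟨hb, u, hu, hbu⟩
    refine ⟨fun φ hφ => ?_, t + u, ?_, fun n => ?_⟩
    · rw [map_add]
      exact add_nonneg (ha φ hφ) (hb φ hφ)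
    · rw [add_mul]
      exact add_nonneg ht hu
    · linear_combination hat n + hbu n
  have Wmul : ∀ c, 0 ≤ c → ∀ a ∈ W, c * a ∈ W := by
    rintro c hc a ⟨ha, t, ht, hat⟩
    obtain ⟨N, hN⟩ := hbdd c
    refine ⟨fun φ hφ => ?_, N * t, ?_, fun n => ?_⟩
    · rw [map_mul]
      exact mul_nonneg (hφ c hc) (ha φ hφ)
    · rw [mul_assoc]
      exact mul_nonneg N.cast_nonneg ht
    · have h1 := mul_nonneg hc (hat n)
      have h2 := mul_nonneg (sub_nonneg.mpr hN) ht
      linear_combination h1 + h2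
  have Wunp : ∀ (k : ℕ) (a : R), 0 < k → (k : R) * a ∈ W → a ∈ W := by
    rintro k a hk ⟨ha, t, ht, hat⟩
    refine ⟨fun φ hφ => ?_, t, ht, fun n => ?_⟩
    · have := ha φ hφ
      rw [map_mul, map_natCast] at this
      exact nonneg_of_mul_nonneg_right this (by exact_mod_cast hk)
    · obtain ⟨i, rfl⟩ : ∃ i, k = i + 1 := ⟨k - 1, by omega⟩
      apply hunperf (i + 1) _ hk
      have h1 := hat n
      have h2 := mul_nonneg (Nat.cast_nonneg (α := R) i) ht
      rw [nsmul_eq_mul]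
      push_cast at h1 ⊢
      linear_combination h1 + h2
  have Wzero : (0 : R) ∈ W := ⟨fun φ _ => by simp, 0, by simp, fun n => by simp⟩
  have WS : ∀ r, 0 ≤ r * s → r ∈ W := fun r hr =>
    ⟨hS r hr, 0, by simp, fun n => by
      rw [add_zero, mul_assoc]
      exact mul_nonneg n.cast_nonneg hr⟩
  have Wint : ∀ y τ, 0 ≤ τ * s → 0 ≤ y → y ≤ τ * s → y ∈ W := by
    intro y τ hτ hy hyτ
    refine ⟨fun φ hφ => hφ y hy, τ, hτ, fun n => ?_⟩
    have := mul_nonneg (nonneg_mul_add_one_of_forall_ringHom_nonneg hunperf hbdd hs n) hy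
    linear_combination this + hyτ
  have hsum : ∀ F : Finset R, (↑F ⊆ {x : R | ∃ r : R, 0 ≤ r * s ∧ 0 ≤ s * r ∧ x = s * r}) →
      ∃ τ, 0 ≤ τ * s ∧ ∑ t ∈ F, t = τ * s := by
    intro F hF
    refine Finset.sum_induction (fun t => t) (fun x => ∃ τ, 0 ≤ τ * s ∧ x = τ * s) ?_ ?_ ?_
    · rintro _ _ ⟨a, ha, rfl⟩ ⟨b, hb, rfl⟩
      exact ⟨a + b, by rw [add_mul]; exact add_nonneg ha hb, by ring⟩
    · exact ⟨0, by simp, by simp⟩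
    · intro x hx
      obtain ⟨r, hr, -, rfl⟩ := hF hx
      exact ⟨r, hr, mul_comm _ _⟩
  have hWspan : Ideal.span W = ⊤ := by
    rw [eq_top_iff, ← hspan, Ideal.span_le]
    rintro x (⟨M, F, -, hF, hl, hu⟩ | hx)
    · obtain ⟨τ, hτ, e⟩ := hsum F hF
      have hτM : 0 ≤ ((M : R) * τ) * s := by
        rw [mul_assoc]
        exact mul_nonneg M.cast_nonneg hτ
      rw [e, nsmul_eq_mul, ← mul_assoc] at hl hu
      have h1 : x + M * τ * s ∈ W := by
        refine Wint _ (2 * (M * τ)) ?_ ?_ ?_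
        · linear_combination hτM + hτM
        · linear_combination hl
        · linear_combination hu
      have h2 : M * τ * s ∈ W := Wint _ _ hτM hτM le_rfl
      have : x = (x + M * τ * s) - M * τ * s := by ring
      rw [this]
      exact Ideal.sub_mem _ (Ideal.subset_span h1) (Ideal.subset_span h2)
    · exact Ideal.subset_span (WS x hx)
  have hdiff : ∀ x ∈ Ideal.span W, ∃ a ∈ W, ∃ b ∈ W, x = a - b := by
    intro x hx
    refine Submodule.span_induction ?_ ?_ ?_ ?_ hx
    · exact fun x hx => ⟨x, hx, 0, Wzero, by simp⟩
    · exact ⟨0, Wzero, 0, Wzero, by simp⟩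
    · rintro _ _ - - ⟨a, ha, b, hb, rfl⟩ ⟨a', ha', b', hb', rfl⟩
      exact ⟨a + a', Wadd _ ha _ ha', b + b', Wadd _ hb _ hb', by ring⟩
    · rintro c _ - ⟨a, ha, b, hb, rfl⟩
      obtain ⟨n, hn⟩ := hbdd (-c)
      have hpos : (0 : R) ≤ c + n := by linear_combination hn
      refine ⟨(c + n) * a + n * b, Wadd _ (Wmul _ hpos _ ha) _ (Wmul _ n.cast_nonneg _ hb),
        (c + n) * b + n * a, Wadd _ (Wmul _ hpos _ hb) _ (Wmul _ n.cast_nonneg _ ha), ?_⟩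
      rw [smul_eq_mul]
      ring
  obtain ⟨a, ha, b, hb, e⟩ := hdiff 1 (hWspan ▸ Submodule.mem_top)
  have h1W : (1 : R) ∈ W := by
    refine one_mem_of_one_add_mem hbdd Wadd Wmul Wunp (t := b) ?_ hb ?_
    · exact_mod_cast nonneg_mul_add_one_of_forall_ringHom_nonneg hunperf hbdd hb.1 2
    · rwa [e, sub_add_cancel]
  obtain ⟨-, t, ht, h⟩ := h1W
  have h1 : (1 : R) ∈ {r : R | 0 ≤ r * s} := by
    refine one_mem_of_one_add_mem hbdd ?_ ?_ ?_ (t := t) ?_ ht ?_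
    · intro a ha b hb
      simp only [Set.mem_ofPred_eq, add_mul] at *
      exact add_nonneg ha hb
    · intro c hc a ha
      simp only [Set.mem_ofPred_eq, mul_assoc] at *
      exact mul_nonneg hc ha
    · intro k a hk ha
      refine hunperf k _ hk ?_
      rwa [nsmul_eq_mul, ← mul_assoc]
    · exact_mod_cast nonneg_mul_add_one_of_forall_ringHom_nonneg hunperf hbdd (hS t ht) 2
    · simpa using h 1
  simpa using h1

end OrderedRing

section TraceSpace

variable {R : Type*} [CommRing R] [PartialOrder R]

theorem continuous_traceSpace_eval (r : R) :
    Continuous fun φ : traceSpace R => (φ : R → ℝ) r :=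
  (continuous_apply r).comp continuous_subtype_val

theorem IsNowhereDense.eq_empty_of_isOpen_subset {X : Type*} [TopologicalSpace X] {Z U : Set X}
    (hZ : IsNowhereDense Z) (hU : IsOpen U) (h : U ⊆ Z) : U = ∅ := by
  have h1 := interior_maximal (h.trans subset_closure) hU
  rw [hZ] at h1
  exact Set.subset_empty_iff.mp h1

theorem traceSpace_nonneg_of_mul_nonneg {s : R}
    (hnwd : IsNowhereDense {φ : traceSpace R | (φ : R → ℝ) s = 0})
    (hs : ∀ φ : R →+* ℝ, (∀ r, 0 ≤ r → 0 ≤ φ r) → 0 ≤ φ s) (r : R) (hr : 0 ≤ r * s)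
    (φ : R →+* ℝ) (hφ : ∀ r, 0 ≤ r → 0 ≤ φ r) : 0 ≤ φ r := by
  by_contra! h
  have hempty : {ψ : traceSpace R | (ψ : R → ℝ) r < 0} = ∅ := by
    refine hnwd.eq_empty_of_isOpen_subset
      (isOpen_lt (continuous_traceSpace_eval r) continuous_const) ?_
    rintro ⟨_, ψ, rfl, hψ⟩ (h : ψ r < 0)
    have h1 := hψ _ hr
    rw [map_mul] at h1
    exact le_antisymm (nonpos_of_mul_nonneg_right h1 h) (hs ψ hψ)
  have : (⟨φ, φ, rfl, hφ⟩ : traceSpace R) ∈ {ψ : traceSpace R | (ψ : R → ℝ) r < 0} := h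
  rw [hempty] at this
  exact this

theorem traceSpace_nonneg_or_nonpos [IsOrderedRing R] {s : R} (hconn : IsConnected (traceSpace R))
    (hnwd : IsNowhereDense {φ : traceSpace R | (φ : R → ℝ) s = 0})
    (hspan : Ideal.span
        (orderIdealGen {x : R | ∃ r : R, 0 ≤ r * s ∧ 0 ≤ s * r ∧ x = s * r} ∪
          {r : R | 0 ≤ r * s}) = ⊤) :
    (∀ φ : R →+* ℝ, (∀ r, 0 ≤ r → 0 ≤ φ r) → 0 ≤ φ s) ∨
      (∀ φ : R →+* ℝ, (∀ r, 0 ≤ r → 0 ≤ φ r) → φ s ≤ 0) := by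
  have : ConnectedSpace (traceSpace R) := isConnected_iff_connectedSpace.mp hconn
  let U : Set (traceSpace R) := {φ | 0 < (φ : R → ℝ) s} ∪
    ⋃ r ∈ {r : R | 0 ≤ r * s}, {φ : traceSpace R | 0 < (φ : R → ℝ) r}
  let V : Set (traceSpace R) := {φ | (φ : R → ℝ) s < 0} ∪
    ⋃ r ∈ {r : R | 0 ≤ r * s}, {φ : traceSpace R | (φ : R → ℝ) r < 0}
  have hU : IsOpen U := (isOpen_lt continuous_const (continuous_traceSpace_eval s)).union
    (isOpen_biUnion fun r _ => isOpen_lt continuous_const (continuous_traceSpace_eval r))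
  have hV : IsOpen V := (isOpen_lt (continuous_traceSpace_eval s) continuous_const).union
    (isOpen_biUnion fun r _ => isOpen_lt (continuous_traceSpace_eval r) continuous_const)
  have hUs : ∀ φ ∈ U, 0 ≤ (φ : R → ℝ) s := by
    rintro ⟨_, φ, rfl, hφ⟩ (h | h)
    · exact le_of_lt h
    · obtain ⟨r, hr, h⟩ := Set.mem_iUnion₂.mp h
      have h1 := hφ _ hr
      rw [map_mul] at h1
      exact nonneg_of_mul_nonneg_right h1 h
  have hVs : ∀ φ ∈ V, (φ : R → ℝ) s ≤ 0 := by
    rintro ⟨_, φ, rfl, hφ⟩ (h | h)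
    · exact le_of_lt h
    · obtain ⟨r, hr, h⟩ := Set.mem_iUnion₂.mp h
      have h1 := hφ _ hr
      rw [map_mul] at h1
      exact nonpos_of_mul_nonneg_right h1 h
  have hUV : U ∩ V = ∅ := hnwd.eq_empty_of_isOpen_subset (hU.inter hV)
    fun φ hφ => le_antisymm (hVs φ hφ.2) (hUs φ hφ.1)
  have hcover : U ∪ V = Set.univ := by
    refine Set.eq_univ_of_forall ?_
    rintro ⟨_, φ, rfl, hφ⟩
    by_contra h
    simp only [U, V, Set.mem_union, Set.mem_iUnion, Set.mem_ofPred_eq, not_or, not_exists,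
      not_lt] at h
    obtain ⟨⟨h1, h2⟩, h3, h4⟩ := h
    have hs0 : φ s = 0 := le_antisymm h1 h3
    have hle : Ideal.span
        (orderIdealGen {x : R | ∃ r : R, 0 ≤ r * s ∧ 0 ≤ s * r ∧ x = s * r} ∪
          {r : R | 0 ≤ r * s}) ≤ RingHom.ker φ := by
      rw [Ideal.span_le]
      rintro x (⟨M, F, -, hF, hl, hu⟩ | hx)
      · have hsum : φ (∑ t ∈ F, t) = 0 := by
          rw [map_sum]
          refine Finset.sum_eq_zero fun t ht => ?_
          obtain ⟨r, -, -, rfl⟩ := hF ht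
          rw [map_mul, hs0, zero_mul]
        have h5 := hφ _ (sub_nonneg.mpr hl)
        have h6 := hφ _ (sub_nonneg.mpr hu)
        rw [map_sub, map_neg, map_nsmul, hsum] at h5
        rw [map_sub, map_nsmul, hsum] at h6
        simp only [smul_zero, neg_zero, sub_zero, zero_sub] at h5 h6
        exact le_antisymm (neg_nonneg.mp h6) h5
      · exact le_antisymm (h2 x hx) (h4 x hx)
    rw [hspan] at hle
    have h1 : (1 : R) ∈ RingHom.ker φ := hle Submodule.mem_top
    rw [RingHom.mem_ker, map_one] at h1
    exact one_ne_zero h1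
  have hcompl : Uᶜ = V := by
    refine Set.Subset.antisymm (fun φ hφ => ?_) (fun φ hφ h => ?_)
    · exact (hcover ▸ Set.mem_univ φ : φ ∈ U ∪ V).resolve_left hφ
    · exact (hUV ▸ (⟨h, hφ⟩ : φ ∈ U ∩ V) : φ ∈ (∅ : Set (traceSpace R)))
  have hclopen : IsClopen U := ⟨⟨hcompl ▸ hV⟩, hU⟩
  rcases isClopen_iff.mp hclopen with h | h
  · right
    intro φ hφ
    refine hVs ⟨φ, φ, rfl, hφ⟩ ?_
    rw [← hcompl, h]
    simp
  · left
    intro φ hφ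
    refine hUs ⟨φ, φ, rfl, hφ⟩ ?_
    rw [h]
    trivial

end TraceSpace

/-- if `X(R)` is connected and nonempty, the zero set of `s` in `X(R)`
is nowhere dense, and the ideal generated by `⟨s·S(s)⟩ ∪ S(s)` is all of `R`, then
`s ∈ R⁺` or `-s ∈ R⁺`. -/
theorem pos_or_neg_of_connected_traceSpace
    (R : Type*) [CommRing R] [PartialOrder R]
    (hadd : ∀ a b c : R, a ≤ b → a + c ≤ b + c)
    (hmulpos : ∀ a b : R, 0 ≤ a → 0 ≤ b → 0 ≤ a * b)
    (hunperf : ∀ (k : ℕ) (g : R), 0 < k → 0 ≤ k • g → 0 ≤ g)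
    (honeunit : ∀ g : R, ∃ M : ℕ, 0 < M ∧ -(M • (1 : R)) ≤ g ∧ g ≤ M • (1 : R))
    (s : R)
    (hconn : IsConnected (traceSpace R))
    (hnwd : IsNowhereDense {φ : traceSpace R | (φ : R → ℝ) s = 0})
    (hspan : Ideal.span
        (orderIdealGen {x : R | ∃ r : R, 0 ≤ r * s ∧ 0 ≤ s * r ∧ x = s * r} ∪
          {r : R | 0 ≤ r * s}) = ⊤) :
    0 ≤ s ∨ 0 ≤ -s := by
  have : IsOrderedAddMonoid R :=
    { add_le_add_left := fun a b h c => hadd a b c h }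
  have hone : (0 : R) ≤ 1 := by
    obtain ⟨M, hM, -, h⟩ := honeunit 0
    exact hunperf M 1 hM h
  have : ZeroLEOneClass R := ⟨hone⟩
  have : IsOrderedRing R := .of_mul_nonneg hmulpos
  have hbdd : ∀ g : R, ∃ n : ℕ, g ≤ n := by
    intro g
    obtain ⟨M, -, -, h⟩ := honeunit g
    exact ⟨M, by rwa [nsmul_one] at h⟩
  rcases traceSpace_nonneg_or_nonpos hconn hnwd hspan with hs | hs
  · exact .inl (nonneg_of_span_eq_top hunperf hbdd hs (traceSpace_nonneg_of_mul_nonneg hnwd hs)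
      hspan)
  · right
    have hs' : ∀ φ : R →+* ℝ, (∀ r, 0 ≤ r → 0 ≤ φ r) → 0 ≤ φ (-s) := fun φ hφ => by
      rw [map_neg]
      exact neg_nonneg.mpr (hs φ hφ)
    have hnwd' : IsNowhereDense {φ : traceSpace R | (φ : R → ℝ) (-s) = 0} := by
      convert hnwd using 3 with φ
      obtain ⟨_, φ, rfl, hφ⟩ := φ
      simp
    refine nonneg_of_span_eq_top hunperf hbdd hs' (traceSpace_nonneg_of_mul_nonneg hnwd' hs') ?_
    have hset : {x : R | ∃ r : R, 0 ≤ r * -s ∧ 0 ≤ -s * r ∧ x = -s * r} =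
        {x : R | ∃ r : R, 0 ≤ r * s ∧ 0 ≤ s * r ∧ x = s * r} := by
      ext x
      constructor
      · rintro ⟨r, h1, h2, rfl⟩
        exact ⟨-r, by simpa using h1, by simpa using h2, by simp⟩
      · rintro ⟨r, h1, h2, rfl⟩
        exact ⟨-r, by simpa using h1, by simpa using h2, by simp⟩
    rw [hset, eq_top_iff, ← hspan, Ideal.span_le]
    rintro x (hx | hx)
    · exact Ideal.subset_span (.inl hx)
    · rw [← neg_neg x]
      refine Ideal.neg_mem_iff _ |>.mpr (Ideal.subset_span (.inr ?_))
      simpa using hx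
end

section
/- Let G be a proper face of K and let β be a polynomial of total degree at most 1 with β ≥ 0 on K and {x ∈ K : β(x) = 0} = G. If γ is any polynomial of total degree at most 1 with γ ≥ 0 on K and γ vanishing identically on G, then there exists a positive integer M such that M·β − γ ∈ C(K). -/
/-- The positive cone `C(K)` of `ℝ[K]`: the smallest subset of `ℝ[x₁,…,xₙ]`
containing every nonnegative real constant and every polynomial of total degree
at most 1 that is nonnegative on `K`, closed under addition and multiplication. -/
inductive PolyCone {n : ℕ} (K : Set (Fin n → ℝ)) : MvPolynomial (Fin n) ℝ → Prop
  | const (c : ℝ) (hc : 0 ≤ c) : PolyCone K (MvPolynomial.C c)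
  | lin (p : MvPolynomial (Fin n) ℝ) (hdeg : p.totalDegree ≤ 1)
      (hpos : ∀ x ∈ K, 0 ≤ MvPolynomial.eval x p) : PolyCone K p
  | add {p q : MvPolynomial (Fin n) ℝ} : PolyCone K p → PolyCone K q → PolyCone K (p + q)
  | mul {p q : MvPolynomial (Fin n) ℝ} : PolyCone K p → PolyCone K q → PolyCone K (p * q)

/-- A face of `K`: a nonempty extreme subset. -/
def IsFaceOf {n : ℕ} (K F : Set (Fin n → ℝ)) : Prop :=
  F.Nonempty ∧ IsExtreme ℝ K F

/-- A facet of `K`: a proper face whose affine span has dimension `n - 1`. -/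
def IsFacetOf {n : ℕ} (K F : Set (Fin n → ℝ)) : Prop :=
  IsFaceOf K F ∧ F ≠ K ∧ Module.finrank ℝ (affineSpan ℝ F).direction = n - 1

/-- An order ideal of `ℝ[K]` (for the ordering given by the cone `C(K)`):
an additive subgroup that is convex and directed. -/
def ConeOrderIdeal {n : ℕ} (K : Set (Fin n → ℝ))
    (I : AddSubgroup (MvPolynomial (Fin n) ℝ)) : Prop :=
  (∀ g h : MvPolynomial (Fin n) ℝ, PolyCone K g → PolyCone K (h - g) → h ∈ I → g ∈ I) ∧
  (∀ i ∈ I, ∃ a b : MvPolynomial (Fin n) ℝ,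
    a ∈ I ∧ PolyCone K a ∧ b ∈ I ∧ PolyCone K b ∧ i = a - b)

/-- Evaluation of a polynomial of total degree at most one respects affine combinations. -/
theorem MvPolynomial.eval_affine_combination {σ R : Type*} [CommRing R]
    {p : MvPolynomial σ R} (hp : p.totalDegree ≤ 1) (x y : σ → R) {a b : R} (hab : a + b = 1) :
    MvPolynomial.eval (a • x + b • y) p =
      a * MvPolynomial.eval x p + b * MvPolynomial.eval y p := by
  simp only [MvPolynomial.eval_eq, Finset.mul_sum, ← Finset.sum_add_distrib]
  refine Finset.sum_congr rfl fun d hd => ?_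
  have hd1 : d.degree ≤ 1 := (MvPolynomial.le_totalDegree hd).trans hp
  rcases Nat.le_one_iff_eq_zero_or_eq_one.mp hd1 with h | h
  · obtain rfl : d = 0 := (Finsupp.degree_eq_zero_iff d).mp h
    simp only [Finsupp.support_zero, Finset.prod_empty]
    linear_combination -(p.coeff 0) * hab
  · obtain ⟨i, rfl⟩ := Finsupp.range_single_one.symm.subset h
    have key (z : σ → R) :
        ∏ j ∈ (Finsupp.single i 1).support, z j ^ (Finsupp.single i 1 : σ →₀ ℕ) j = z i := by
      simp
    simp only [key, Pi.add_apply, Pi.smul_apply, smul_eq_mul]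
    ring

/-- A polynomial of total degree at most one that is nonnegative on a set is nonnegative on its
convex hull. -/
theorem MvPolynomial.eval_nonneg_of_mem_convexHull {σ : Type*}
    {p : MvPolynomial σ ℝ} (hp : p.totalDegree ≤ 1) {s : Set (σ → ℝ)}
    (hs : ∀ x ∈ s, 0 ≤ MvPolynomial.eval x p) {x : σ → ℝ} (hx : x ∈ convexHull ℝ s) :
    0 ≤ MvPolynomial.eval x p := by
  have hconv : Convex ℝ {x : σ → ℝ | 0 ≤ MvPolynomial.eval x p} := by
    intro x hx y hy a b ha hb hab
    rw [Set.mem_ofPred_eq, MvPolynomial.eval_affine_combination hp x y hab]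
    exact add_nonneg (mul_nonneg ha hx) (mul_nonneg hb hy)
  exact convexHull_min hs hconv hx

/-- On a finite set, a nonnegative function `f` whose zeros are zeros of `g` has a multiple
dominating `g`. -/
theorem Finset.exists_pos_nat_forall_le_mul {α : Type*} (s : Finset α) (f g : α → ℝ)
    (hf : ∀ x ∈ s, 0 ≤ f x) (hfg : ∀ x ∈ s, f x = 0 → g x = 0) :
    ∃ M : ℕ, 0 < M ∧ ∀ x ∈ s, g x ≤ M * f x := by
  obtain ⟨B, hB⟩ := (s.image fun x => g x / f x).bddAbove
  obtain ⟨N, hN⟩ := exists_nat_ge B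
  refine ⟨N + 1, N.succ_pos, fun x hx => ?_⟩
  rcases (hf x hx).eq_or_lt' with h | h
  · simp [h, hfg x hx h]
  · have hle : g x / f x ≤ B := hB (by simpa using ⟨x, hx, rfl⟩)
    rw [← div_le_iff₀ h]
    push_cast
    linarith

/-- Proposition 4(i): if `β` is a degree ≤ 1 polynomial, nonnegative
on `K`, whose zero set in `K` is exactly the proper face `G`, and `γ` is a degree
≤ 1 polynomial nonnegative on `K` vanishing on `G`, then `M·β − γ ∈ C(K)` for some
positive integer `M`. -/
theorem exists_nsmul_sub_mem_polyCone
    (n : ℕ) (hn : 1 ≤ n) (K : Set (Fin n → ℝ))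
    (hKpoly : ∃ S : Finset (Fin n → ℝ), K = convexHull ℝ (↑S : Set (Fin n → ℝ)))
    (hKint : (interior K).Nonempty)
    (G : Set (Fin n → ℝ)) (hG : IsFaceOf K G) (hGproper : G ≠ K)
    (β : MvPolynomial (Fin n) ℝ) (hβdeg : β.totalDegree ≤ 1)
    (hβpos : ∀ x ∈ K, 0 ≤ MvPolynomial.eval x β)
    (hβzero : {x ∈ K | MvPolynomial.eval x β = 0} = G)
    (γ : MvPolynomial (Fin n) ℝ) (hγdeg : γ.totalDegree ≤ 1)
    (hγpos : ∀ x ∈ K, 0 ≤ MvPolynomial.eval x γ)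
    (hγG : ∀ x ∈ G, MvPolynomial.eval x γ = 0) :
    ∃ M : ℕ, 0 < M ∧ PolyCone K (M • β - γ) := by
  obtain ⟨S, rfl⟩ := hKpoly
  have hS : (S : Set (Fin n → ℝ)) ⊆ convexHull ℝ S := subset_convexHull ℝ _
  obtain ⟨M, hM, hle⟩ := S.exists_pos_nat_forall_le_mul
    (fun x => MvPolynomial.eval x β) (fun x => MvPolynomial.eval x γ)
    (fun x hx => hβpos x (hS hx)) (fun x hx h => hγG x (hβzero ▸ ⟨hS hx, h⟩))
  have hdeg : (M • β - γ).totalDegree ≤ 1 :=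
    (MvPolynomial.totalDegree_sub _ _).trans
      (max_le ((MvPolynomial.totalDegree_smul_le _ _).trans hβdeg) hγdeg)
  refine ⟨M, hM, .lin _ hdeg fun x hx =>
    MvPolynomial.eval_nonneg_of_mem_convexHull hdeg (fun v hv => ?_) hx⟩
  simpa using hle v hv
end

section
/- Let G be a proper face of K and let β be a polynomial of total degree at most 1 with β ≥ 0 on K and {x ∈ K : β(x) = 0} = G. Then β is an order unit of the order ideal I(G) = {f ∈ ℝ[K] : f vanishes identically on G}: for every f ∈ I(G) there is a positive integer M such that M·β − f ∈ C(K) and M·β + f ∈ C(K). -/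
open MvPolynomial

/-- A polynomial of total degree at most 1 evaluates as an affine function. -/
theorem eval_affineCombination_of_totalDegree_le_one {σ : Type*} [Fintype σ]
    {p : MvPolynomial σ ℝ} (hp : p.totalDegree ≤ 1) (x y : σ → ℝ) {a b : ℝ} (hab : a + b = 1) :
    eval (a • x + b • y) p = a * eval x p + b * eval y p := by
  classical
  simp only [eval_eq', Finset.mul_sum, ← Finset.sum_add_distrib]
  refine Finset.sum_congr rfl fun d hd => ?_
  have hdeg : d.degree ≤ 1 := (le_totalDegree hd).trans hp
  rcases Nat.le_one_iff_eq_zero_or_eq_one.mp hdeg with h | h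
  · rw [Finsupp.degree_eq_zero_iff] at h
    subst h
    simp [← add_mul, hab]
  · obtain ⟨i, rfl⟩ := (Finsupp.sum_eq_one_iff d).mp h
    have key : ∀ z : σ → ℝ, ∏ j, z j ^ (Finsupp.single i 1 : σ →₀ ℕ) j = z i := fun z => by
      rw [Finset.prod_eq_single i] <;> simp +contextual [eq_comm]
    simp only [key, Pi.add_apply, Pi.smul_apply, smul_eq_mul]
    ring

theorem convex_setOf_eval_nonneg {σ : Type*} [Fintype σ] {p : MvPolynomial σ ℝ}
    (hp : p.totalDegree ≤ 1) : Convex ℝ {x : σ → ℝ | 0 ≤ eval x p} := by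
  intro x hx y hy a b ha hb hab
  simp only [Set.mem_ofPred_eq] at hx hy ⊢
  rw [eval_affineCombination_of_totalDegree_le_one hp x y hab]
  positivity

theorem convex_setOf_eval_eq_zero {σ : Type*} [Fintype σ] {p : MvPolynomial σ ℝ}
    (hp : p.totalDegree ≤ 1) : Convex ℝ {x : σ → ℝ | eval x p = 0} := by
  intro x hx y hy a b _ _ hab
  simp only [Set.mem_ofPred_eq] at hx hy ⊢
  simp [eval_affineCombination_of_totalDegree_le_one hp x y hab, hx, hy]

/-- A polynomial vanishing on a convex set vanishes on its affine span. -/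
theorem eval_eq_zero_of_mem_affineSpan {σ : Type*} [Fintype σ] {G : Set (σ → ℝ)}
    (hconv : Convex ℝ G) (hne : G.Nonempty) {f : MvPolynomial σ ℝ}
    (hf : ∀ x ∈ G, eval x f = 0) {y : σ → ℝ} (hy : y ∈ affineSpan ℝ G) : eval y f = 0 := by
  obtain ⟨c, hc⟩ := hne.intrinsicInterior hconv
  obtain ⟨c, hc, rfl⟩ := mem_intrinsicInterior.mp hc
  let line : ℝ → affineSpan ℝ G := fun t =>
    ⟨AffineMap.lineMap (c : σ → ℝ) y t, AffineMap.lineMap_mem t c.2 hy⟩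
  have hline : Continuous line :=
    Continuous.subtype_mk AffineMap.lineMap_continuous _
  let q : Polynomial ℝ := aeval
    (fun i => Polynomial.C ((c : σ → ℝ) i) + Polynomial.X * Polynomial.C (y i - (c : σ → ℝ) i)) f
  have hq : ∀ t : ℝ, q.eval t = eval (AffineMap.lineMap (c : σ → ℝ) y t) f := fun t => by
    simp only [q]
    rw [← Polynomial.coe_aeval_eq_eval, MvPolynomial.comp_aeval_apply, ← MvPolynomial.coe_aeval_eq_eval]
    change _ = aeval _ f
    congr 2
    ext i
    simp [AffineMap.lineMap_apply, add_comm]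
  have hopen : IsOpen (line ⁻¹' interior (((↑) : affineSpan ℝ G → σ → ℝ) ⁻¹' G)) :=
    isOpen_interior.preimage hline
  have hmem : (0 : ℝ) ∈ line ⁻¹' interior (((↑) : affineSpan ℝ G → σ → ℝ) ⁻¹' G) := by
    have : line 0 = c := Subtype.ext (AffineMap.lineMap_apply_zero _ _)
    simpa [this] using hc
  have hq0 : q = 0 := by
    refine Polynomial.eq_zero_of_infinite_isRoot q
      ((infinite_of_mem_nhds (0 : ℝ) (hopen.mem_nhds hmem)).mono fun t ht => ?_)
    rw [Set.mem_ofPred_eq, Polynomial.IsRoot, hq]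
    exact hf _ (interior_subset (s := ((↑) : affineSpan ℝ G → σ → ℝ) ⁻¹' G) ht)
  simpa [hq0] using (hq 1).symm

/-- The polynomials vanishing on a nonempty convex set lie in every ideal containing the
polynomials of total degree at most 1 that vanish on it. -/
theorem mem_ideal_of_vanishing_of_convex {σ : Type*} [Fintype σ] {G : Set (σ → ℝ)}
    (hconv : Convex ℝ G) (hne : G.Nonempty) {J : Ideal (MvPolynomial σ ℝ)}
    (hJ : ∀ l : MvPolynomial σ ℝ, l.totalDegree ≤ 1 → (∀ x ∈ G, eval x l = 0) → l ∈ J)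
    {f : MvPolynomial σ ℝ} (hf : ∀ x ∈ G, eval x f = 0) : f ∈ J := by
  classical
  obtain ⟨g, hg⟩ := hne
  set D := (affineSpan ℝ G).direction
  obtain ⟨P, hP⟩ := D.subtype.exists_leftInverse_of_injective D.ker_subtype
  have hPD : ∀ v (hv : v ∈ D), (P v : σ → ℝ) = v := fun v hv =>
    congrArg Subtype.val (LinearMap.congr_fun hP ⟨v, hv⟩)
  -- the coordinates of the affine retraction `x ↦ g + P (x - g)` onto the affine span
  let r : σ → MvPolynomial σ ℝ := fun i =>
    C (g i) + ∑ j, C ((P (Pi.single j 1) : σ → ℝ) i) * (X j - C (g j))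
  have hr : ∀ x i, eval x (r i) = g i + (P (x - g) : σ → ℝ) i := fun x i => by
    have hx : (P (x - g) : σ → ℝ) = ∑ j, (x j - g j) • (P (Pi.single j 1) : σ → ℝ) := by
      conv_lhs => rw [pi_eq_sum_univ' (x - g)]
      simp [map_sum, Pi.single]
    rw [hx]
    simp [r, mul_comm]
  have hrdeg : ∀ i, (X i - r i).totalDegree ≤ 1 := fun i => by
    refine (totalDegree_sub _ _).trans (max_le (totalDegree_X i).le ?_)
    refine (totalDegree_add _ _).trans (max_le (by simp) ?_)
    refine totalDegree_finsetSum_le fun j _ => (totalDegree_mul _ _).trans ?_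
    rw [totalDegree_C, zero_add]
    exact (totalDegree_sub _ _).trans (max_le (totalDegree_X j).le (by simp))
  have hrJ : ∀ i, X i - r i ∈ J := fun i => by
    refine hJ _ (hrdeg i) fun x hx => ?_
    have hxg : x - g ∈ D := AffineSubspace.vsub_mem_direction
      (subset_affineSpan ℝ G hx) (subset_affineSpan ℝ G hg)
    rw [map_sub, eval_X, hr, hPD _ hxg]
    simp
  have hzero : bind₁ r f = 0 := MvPolynomial.funext fun x => by
    have : eval x (bind₁ r f) = eval (fun i => eval x (r i)) f := by
      simp only [← MvPolynomial.coe_aeval_eq_eval, RingHom.coe_coe, aeval_bind₁]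
    rw [this, map_zero]
    refine eval_eq_zero_of_mem_affineSpan hconv ⟨g, hg⟩ hf ?_
    have hmem := AffineSubspace.vadd_mem_of_mem_direction (P (x - g)).2
      (subset_affineSpan ℝ G hg)
    convert hmem using 1
    ext i
    simp [hr, add_comm]
  have hmk : (Ideal.Quotient.mkₐ ℝ J).comp (bind₁ r) = Ideal.Quotient.mkₐ ℝ J := by
    ext i
    simpa using ((Ideal.Quotient.eq (I := J)).mpr (hrJ i)).symm
  rw [← Ideal.Quotient.eq_zero_iff_mem]
  simpa [hzero] using (AlgHom.congr_fun hmk f).symm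

namespace PolyCone

variable {n : ℕ} {K : Set (Fin n → ℝ)}

/-- `f` is bounded by `b`, i.e. `-b ≤ f ≤ b` in `ℝ[K]`. -/
def IsBoundedBy (K : Set (Fin n → ℝ)) (b f : MvPolynomial (Fin n) ℝ) : Prop :=
  PolyCone K (b - f) ∧ PolyCone K (b + f)

namespace IsBoundedBy

variable {b c f h : MvPolynomial (Fin n) ℝ}

theorem add (hf : IsBoundedBy K b f) (hh : IsBoundedBy K c h) : IsBoundedBy K (b + c) (f + h) :=
  ⟨by simpa only [add_sub_add_comm] using PolyCone.add hf.1 hh.1,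
    by simpa only [add_add_add_comm] using PolyCone.add hf.2 hh.2⟩

theorem mul (hf : IsBoundedBy K b f) (hh : IsBoundedBy K c h) :
    IsBoundedBy K (b * c) (f * h) := by
  have half : (C (1 / 2) : MvPolynomial (Fin n) ℝ) * 2 = 1 := by
    rw [← map_ofNat (C : ℝ →+* MvPolynomial (Fin n) ℝ) 2, ← C_mul]
    norm_num
  have hhalf := const (K := K) (1 / 2) (by norm_num)
  constructor
  · convert hhalf.mul ((hf.2.mul hh.1).add (hf.1.mul hh.2)) using 1
    linear_combination (-(b * c - f * h)) * half
  · convert hhalf.mul ((hf.2.mul hh.2).add (hf.1.mul hh.1)) using 1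
    linear_combination (-(b * c + f * h)) * half

end IsBoundedBy

/-- On a polytope, an affine form is bounded by a multiple of every nonnegative affine form
whose zeros among the vertices are zeros of the former. -/
theorem exists_isBoundedBy_nsmul {S : Finset (Fin n → ℝ)} {β l : MvPolynomial (Fin n) ℝ}
    (hβdeg : β.totalDegree ≤ 1) (hldeg : l.totalDegree ≤ 1) (hβ : ∀ s ∈ S, 0 ≤ eval s β)
    (hl : ∀ s ∈ S, eval s β = 0 → eval s l = 0) :
    ∃ m : ℕ, IsBoundedBy (convexHull ℝ (S : Set (Fin n → ℝ))) (m • β) l := by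
  let m := S.sup fun s => ⌈|eval s l| / eval s β⌉₊
  have hm : ∀ s ∈ S, |eval s l| ≤ m * eval s β := fun s hs => by
    rcases (hβ s hs).eq_or_lt with h | h
    · simp [hl s hs h.symm, ← h]
    · rw [← div_le_iff₀ h]
      exact (Nat.le_ceil _).trans
        (Nat.cast_le.mpr (Finset.le_sup (f := fun s => ⌈|eval s l| / eval s β⌉₊) hs))
  have hmdeg : (m • β).totalDegree ≤ 1 := (totalDegree_smul_le m β).trans hβdeg
  refine ⟨m, lin _ ((totalDegree_sub _ _).trans (max_le hmdeg hldeg)) ?_,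
    lin _ ((totalDegree_add _ _).trans (max_le hmdeg hldeg)) ?_⟩
  · refine fun x hx => convexHull_min (fun s hs => ?_) (convex_setOf_eval_nonneg
      ((totalDegree_sub _ _).trans (max_le hmdeg hldeg))) hx
    have := (le_abs_self _).trans (hm s hs)
    simpa using this
  · refine fun x hx => convexHull_min (fun s hs => ?_) (convex_setOf_eval_nonneg
      ((totalDegree_add _ _).trans (max_le hmdeg hldeg))) hx
    have := (neg_le_abs _).trans (hm s hs)
    simp
    linarith

/-- The constant 1 is an order unit of `ℝ[K]`. -/
theorem exists_isBoundedBy_natCast (S : Finset (Fin n → ℝ)) (h : MvPolynomial (Fin n) ℝ) :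
    ∃ m : ℕ, IsBoundedBy (convexHull ℝ (S : Set (Fin n → ℝ))) m h := by
  have affine : ∀ l : MvPolynomial (Fin n) ℝ, l.totalDegree ≤ 1 →
      ∃ m : ℕ, IsBoundedBy (convexHull ℝ (S : Set (Fin n → ℝ))) m l := fun l hl => by
    simpa using exists_isBoundedBy_nsmul (S := S) (β := 1) (by simp) hl (by simp) (by simp)
  induction h using MvPolynomial.induction_on with
  | C a => exact affine _ (by simp)
  | add p q hp hq =>
    obtain ⟨⟨a, ha⟩, b, hb⟩ := hp, hq
    exact ⟨a + b, by simpa using ha.add hb⟩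
  | mul_X p i hp =>
    obtain ⟨⟨a, ha⟩, b, hb⟩ := hp, affine _ (totalDegree_X i).le
    exact ⟨a * b, by simpa using ha.mul hb⟩

/-- The ideal of polynomials bounded by a multiple of `β`. -/
def boundedIdeal (S : Finset (Fin n → ℝ)) (β : MvPolynomial (Fin n) ℝ) :
    Ideal (MvPolynomial (Fin n) ℝ) where
  carrier := {f | ∃ m : ℕ, IsBoundedBy (convexHull ℝ (S : Set (Fin n → ℝ))) (m • β) f}
  zero_mem' := ⟨0, by simpa [IsBoundedBy] using const 0 le_rfl⟩
  add_mem' := by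
    rintro p q ⟨a, ha⟩ ⟨b, hb⟩
    exact ⟨a + b, by simpa only [add_smul] using ha.add hb⟩
  smul_mem' := by
    rintro h p ⟨a, ha⟩
    obtain ⟨b, hb⟩ := exists_isBoundedBy_natCast S h
    exact ⟨b * a, by simpa [mul_assoc] using hb.mul ha⟩

end PolyCone

/-- Proposition 4(iii): a degree ≤ 1 polynomial `β ≥ 0` on `K` whose
zero set in `K` is the proper face `G` is an order unit of the order ideal
`I(G)` of polynomials vanishing on `G`. -/
theorem facetForm_isOrderUnit_of_vanishingIdeal
    (n : ℕ) (hn : 1 ≤ n) (K : Set (Fin n → ℝ))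
    (hKpoly : ∃ S : Finset (Fin n → ℝ), K = convexHull ℝ (↑S : Set (Fin n → ℝ)))
    (hKint : (interior K).Nonempty)
    (G : Set (Fin n → ℝ)) (hG : IsFaceOf K G) (hGproper : G ≠ K)
    (β : MvPolynomial (Fin n) ℝ) (hβdeg : β.totalDegree ≤ 1)
    (hβpos : ∀ x ∈ K, 0 ≤ MvPolynomial.eval x β)
    (hβzero : {x ∈ K | MvPolynomial.eval x β = 0} = G) :
    ∀ f : MvPolynomial (Fin n) ℝ, (∀ x ∈ G, MvPolynomial.eval x f = 0) →
      ∃ M : ℕ, 0 < M ∧ PolyCone K (M • β - f) ∧ PolyCone K (M • β + f) := by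
  intro f hf
  obtain ⟨S, rfl⟩ := hKpoly
  have hS : ∀ s ∈ S, s ∈ convexHull ℝ (S : Set (Fin n → ℝ)) := fun s hs => subset_convexHull ℝ _ hs
  have hGconv : Convex ℝ G := by
    rw [← hβzero]
    exact (convex_convexHull ℝ _).inter (convex_setOf_eval_eq_zero hβdeg)
  obtain ⟨m, hm⟩ : f ∈ PolyCone.boundedIdeal S β :=
    mem_ideal_of_vanishing_of_convex hGconv hG.1 (fun l hldeg hl =>
      PolyCone.exists_isBoundedBy_nsmul hβdeg hldeg (fun s hs => hβpos s (hS s hs))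
        fun s hs h => hl s (hβzero ▸ ⟨hS s hs, h⟩)) hf
  have hβ := PolyCone.lin β hβdeg hβpos
  exact ⟨m + 1, m.succ_pos, by simpa only [succ_nsmul', add_sub_assoc] using hβ.add hm.1,
    by simpa only [succ_nsmul', add_assoc] using hβ.add hm.2⟩
end

section
/- Let I be an order ideal of ℝ[K] and let Z(I) = {x ∈ ℝⁿ : f(x) = 0 for every f ∈ I} be its real zero set. Then Z(I) ∩ K is Zariski dense in Z(I): every polynomial f ∈ ℝ[x₁,…,xₙ] that vanishes identically on Z(I) ∩ K vanishes identically on Z(I). -/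
open MvPolynomial in
/-- A polynomial of total degree at most one commutes with affine combinations. -/
lemma eval_sum_smul_of_totalDegree_le_one {σ : Type*} {p : MvPolynomial σ ℝ}
    (hp : p.totalDegree ≤ 1) (s : Finset (σ → ℝ)) (w : (σ → ℝ) → ℝ) (hw : ∑ y ∈ s, w y = 1) :
    eval (∑ y ∈ s, w y • y) p = ∑ y ∈ s, w y * eval y p := by
  classical
  simp only [eval_eq, Finset.mul_sum]
  rw [Finset.sum_comm]
  refine Finset.sum_congr rfl fun d hd => ?_
  have hdeg : d.degree ≤ 1 := (le_totalDegree hd).trans hp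
  rcases Nat.le_one_iff_eq_zero_or_eq_one.mp hdeg with h0 | h1
  · obtain rfl : d = 0 := (Finsupp.degree_eq_zero_iff d).mp h0
    simp [← Finset.sum_mul, hw]
  · obtain ⟨i, rfl⟩ : d ∈ Set.range fun i => Finsupp.single i 1 := by
      rwa [Finsupp.range_single_one]
    simp [Finsupp.support_single, Finset.mul_sum, Finset.sum_apply, mul_left_comm]

namespace PolyCone

open MvPolynomial

variable {n : ℕ} {K : Set (Fin n → ℝ)} {S : Finset (Fin n → ℝ)} {p q : MvPolynomial (Fin n) ℝ}

lemma zero : PolyCone K 0 := by simpa using PolyCone.const (K := K) 0 le_rfl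

lemma one : PolyCone K 1 := by simpa using PolyCone.const (K := K) 1 zero_le_one

lemma pow (hp : PolyCone K p) (k : ℕ) : PolyCone K (p ^ k) := by
  induction k with
  | zero => simpa using one
  | succ k ih => simpa [pow_succ] using ih.mul hp

lemma eval_nonneg (hp : PolyCone K p) {x : Fin n → ℝ} (hx : x ∈ K) : 0 ≤ eval x p := by
  induction hp with
  | const c hc => simpa using hc
  | lin p _ hpos => exact hpos x hx
  | add _ _ ihp ihq => simpa using add_nonneg ihp ihq
  | mul _ _ ihp ihq => simpa using mul_nonneg ihp ihq

lemma pow_sub_pow (hp : PolyCone K p) (hq : PolyCone K q) (h : PolyCone K (q - p)) (k : ℕ) :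
    PolyCone K (q ^ k - p ^ k) := by
  induction k with
  | zero => simpa using zero
  | succ k ih =>
    have : q ^ (k + 1) - p ^ (k + 1) = q * (q ^ k - p ^ k) + (q - p) * p ^ k := by ring
    rw [this]
    exact (hq.mul ih).add (h.mul (hp.pow k))

/-- Nonnegativity of an affine polynomial on a polytope can be checked on the generating points. -/
lemma lin_of_forall_vertex (hdeg : p.totalDegree ≤ 1) (h : ∀ v ∈ S, 0 ≤ eval v p) :
    PolyCone (convexHull ℝ (S : Set (Fin n → ℝ))) p := by
  refine .lin p hdeg fun x hx => ?_
  obtain ⟨w, hw0, hw1, rfl⟩ := Finset.mem_convexHull'.mp hx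
  rw [eval_sum_smul_of_totalDegree_le_one hdeg S w hw1]
  exact Finset.sum_nonneg fun y hy => mul_nonneg (hw0 y hy) (h y hy)

/-- Every element of the cone of a polytope is bounded above by a natural number. -/
lemma exists_nat_sub (hp : PolyCone (convexHull ℝ (S : Set (Fin n → ℝ))) p) :
    ∃ N : ℕ, PolyCone (convexHull ℝ (S : Set (Fin n → ℝ))) (C (N : ℝ) - p) := by
  induction hp with
  | const c hc =>
    obtain ⟨N, hN⟩ := exists_nat_ge c
    exact ⟨N, by rw [← C_sub]; exact .const _ (sub_nonneg.mpr hN)⟩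
  | lin p hdeg _ =>
    obtain ⟨N, hN⟩ := exists_nat_ge (∑ v ∈ S, |eval v p|)
    refine ⟨N, lin_of_forall_vertex ((totalDegree_sub _ _).trans
      (max_le ((totalDegree_C _).le.trans zero_le_one) hdeg))
      fun v hv => ?_⟩
    have := Finset.single_le_sum (f := fun v => |eval v p|) (fun _ _ => abs_nonneg _) hv
    have := le_abs_self (eval v p)
    simp only [map_sub, eval_C]
    linarith
  | @add p q _ _ ihp ihq =>
    obtain ⟨a, ha⟩ := ihp
    obtain ⟨b, hb⟩ := ihq
    refine ⟨a + b, ?_⟩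
    have : C ((a + b : ℕ) : ℝ) - (p + q) = (C (a : ℝ) - p) + (C (b : ℝ) - q) := by
      push_cast [C_add]; ring
    exact this ▸ ha.add hb
  | @mul p q _ hq ihp ihq =>
    obtain ⟨a, ha⟩ := ihp
    obtain ⟨b, hb⟩ := ihq
    refine ⟨a * b, ?_⟩
    have : C ((a * b : ℕ) : ℝ) - p * q = C (a : ℝ) * (C (b : ℝ) - q) + (C (a : ℝ) - p) * q := by
      push_cast [C_mul]; ring
    exact this ▸ ((PolyCone.const _ a.cast_nonneg).mul hb).add (ha.mul hq)

end PolyCone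

namespace ConeOrderIdeal

open MvPolynomial

variable {n : ℕ} {K : Set (Fin n → ℝ)} {I : AddSubgroup (MvPolynomial (Fin n) ℝ)}

lemma mul_mem (hI : ConeOrderIdeal K I)
    (hb : ∀ p, PolyCone K p → ∃ N : ℕ, PolyCone K (C (N : ℝ) - p))
    {p g : MvPolynomial (Fin n) ℝ} (hp : PolyCone K p) (hg : PolyCone K g) (hgI : g ∈ I) :
    p * g ∈ I := by
  obtain ⟨N, hN⟩ := hb p hp
  refine hI.1 (p * g) (N • g) (hp.mul hg) ?_ (I.nsmul_mem hgI N)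
  have : N • g - p * g = (C (N : ℝ) - p) * g := by simp [sub_mul]
  exact this ▸ hN.mul hg

/-- The positive part of an order ideal vanishing at `x` is contained in a prime, convex,
additively closed subset of the cone whose elements still vanish at `x`. -/
lemma exists_prime (hI : ConeOrderIdeal K I)
    (hb : ∀ p, PolyCone K p → ∃ N : ℕ, PolyCone K (C (N : ℝ) - p))
    {x : Fin n → ℝ} (hx : ∀ g ∈ I, eval x g = 0) :
    ∃ T : AddSubmonoid (MvPolynomial (Fin n) ℝ),
      (∀ g ∈ T, eval x g = 0) ∧ (∀ g ∈ I, PolyCone K g → g ∈ T) ∧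
      (∀ p q, PolyCone K p → PolyCone K (q - p) → q ∈ T → p ∈ T) ∧
      (∀ p q, PolyCone K p → PolyCone K q → p * q ∈ T → p ∈ T ∨ q ∈ T) ∧
      ∀ g ∈ T, PolyCone K g := by
  let M₀ : Submonoid (MvPolynomial (Fin n) ℝ) :=
    { carrier := {g | PolyCone K g ∧ eval x g ≠ 0}
      one_mem' := ⟨.one, by simp⟩
      mul_mem' := fun ha hb => ⟨ha.1.mul hb.1, by simpa using ⟨ha.2, hb.2⟩⟩ }
  obtain ⟨M, hM₀, hM⟩ := zorn_le_nonempty₀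
    {M : Submonoid (MvPolynomial (Fin n) ℝ) | ∀ g ∈ M, PolyCone K g ∧ g ∉ I}
    (fun c hc hchain N hN => ⟨sSup c, fun g hg => by
      obtain ⟨P, hP, hgP⟩ :=
        (Submonoid.mem_sSup_of_directedOn ⟨N, hN⟩ hchain.directedOn).mp hg
      exact hc hP g hgP, fun P hP => le_sSup hP⟩)
    M₀ (fun g hg => ⟨hg.1, fun hgI => hg.2 (hx g hgI)⟩)
  have hMcone : ∀ g ∈ M, PolyCone K g := fun g hg => (hM.prop g hg).1
  have key : ∀ p, PolyCone K p → (p ∉ M ↔ ∃ k : ℕ, ∃ m ∈ M, p ^ k * m ∈ I) := by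
    intro p hp
    constructor
    · intro hpM
      by_contra! hcon
      refine hpM (hM.le_of_ge (y := Submonoid.powers p ⊔ M) ?_ le_sup_right
        (Submonoid.mem_sup_left (Submonoid.mem_powers p)))
      intro g hg
      obtain ⟨_, ⟨k, rfl⟩, m, hm, rfl⟩ := Submonoid.mem_sup.mp hg
      exact ⟨(hp.pow k).mul (hMcone m hm), hcon k m hm⟩
    · rintro ⟨k, m, hm, h⟩ hpM
      exact (hM.prop _ (M.mul_mem (M.pow_mem hpM k) hm)).2 h
  let T : AddSubmonoid (MvPolynomial (Fin n) ℝ) :=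
    { carrier := {g | PolyCone K g ∧ g ∉ M}
      zero_mem' := ⟨.zero, fun h => (hM.prop _ h).2 I.zero_mem⟩
      add_mem' := by
        rintro p q ⟨hp, hpM⟩ ⟨hq, hqM⟩
        refine ⟨hp.add hq, (key _ (hp.add hq)).mpr ?_⟩
        obtain ⟨k, m, hm, hk⟩ := (key p hp).mp hpM
        obtain ⟨j, m', hm', hj⟩ := (key q hq).mp hqM
        have hmc := hMcone m hm
        have hmc' := hMcone m' hm'
        refine ⟨k + j, m * m', M.mul_mem hm hm', ?_⟩
        rw [add_pow, Finset.sum_mul]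
        refine I.sum_mem fun i hi => ?_
        have hi' : i ≤ k + j := Nat.lt_succ_iff.mp (Finset.mem_range.mp hi)
        have hch : PolyCone K (((k + j).choose i : ℕ) : MvPolynomial (Fin n) ℝ) := by
          simpa using PolyCone.const (K := K) ((k + j).choose i : ℝ) (Nat.cast_nonneg _)
        rcases le_total k i with h | h
        · obtain ⟨e, rfl⟩ := Nat.exists_eq_add_of_le h
          convert hI.mul_mem hb
            (((hp.pow e).mul (hq.pow (k + j - (k + e)))).mul (hch.mul hmc'))
            ((hp.pow k).mul hmc) hk using 1
          ring
        · obtain ⟨e, he⟩ := Nat.exists_eq_add_of_le (show j ≤ k + j - i by lia)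
          rw [he]
          convert hI.mul_mem hb (((hp.pow i).mul (hq.pow e)).mul (hch.mul hmc))
            ((hq.pow j).mul hmc') hj using 1
          ring }
  refine ⟨T, ?_, ?_, ?_, ?_, fun g hg => hg.1⟩
  · rintro g ⟨hg, hgM⟩
    by_contra h
    exact hgM (hM₀ ⟨hg, h⟩)
  · exact fun g hgI hg => ⟨hg, fun h => (hM.prop g h).2 hgI⟩
  · rintro p q hp hpq ⟨hq, hqM⟩
    refine ⟨hp, (key p hp).mpr ?_⟩
    obtain ⟨k, m, hm, hk⟩ := (key q hq).mp hqM
    have hmc := hMcone m hm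
    refine ⟨k, m, hm, hI.1 _ _ ((hp.pow k).mul hmc) ?_ hk⟩
    rw [← sub_mul]
    exact (hp.pow_sub_pow hq hpq k).mul hmc
  · rintro p q hp hq ⟨-, h⟩
    by_contra! hcon
    have hp' : p ∈ M := by_contra fun h' => hcon.1 ⟨hp, h'⟩
    have hq' : q ∈ M := by_contra fun h' => hcon.2 ⟨hq, h'⟩
    exact h (M.mul_mem hp' hq')

end ConeOrderIdeal

open MvPolynomial in
/-- A point that is not an affine combination of a finite set is separated from it by a
polynomial of degree at most one. -/
lemma exists_affine_combination_or_separating {n : ℕ} (W : Finset (Fin n → ℝ)) (x : Fin n → ℝ) :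
    (∃ a : (Fin n → ℝ) → ℝ, ∑ w ∈ W, a w = 1 ∧ ∑ w ∈ W, a w • w = x) ∨
    ∃ φ : MvPolynomial (Fin n) ℝ, φ.totalDegree ≤ 1 ∧ (∀ w ∈ W, eval w φ = 0) ∧ eval x φ ≠ 0 := by
  classical
  let ι : (Fin n → ℝ) → (Fin n → ℝ) × ℝ := fun y => (y, 1)
  by_cases h : ι x ∈ Submodule.span ℝ (ι '' W)
  · left
    obtain ⟨a, ha⟩ := (Submodule.mem_span_image_finset_iff_exists_fun ℝ).mp h
    refine ⟨Function.extend Subtype.val a 0, ?_, ?_⟩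
    · rw [← Finset.sum_coe_sort]
      simpa [ι, Prod.snd_sum, Subtype.val_injective.extend_apply] using congrArg Prod.snd ha
    · rw [← Finset.sum_coe_sort]
      simpa [ι, Prod.fst_sum, Subtype.val_injective.extend_apply] using congrArg Prod.fst ha
  · right
    obtain ⟨ψ, hψ, hker⟩ := Submodule.exists_le_ker_of_notMem h
    let φ : MvPolynomial (Fin n) ℝ := C (ψ (0, 1)) + ∑ i, C (ψ (Pi.single i 1, 0)) * X i
    have hφ : ∀ y, eval y φ = ψ (ι y) := by
      intro y
      have : ι y = (0, 1) + ∑ i, y i • ((Pi.single i 1, 0) : (Fin n → ℝ) × ℝ) := by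
        refine Prod.ext ?_ ?_
        · simpa [ι, Prod.fst_sum] using pi_eq_sum_univ' y
        · simp [ι, Prod.snd_sum]
      rw [this]
      simp [φ, mul_comm, -Prod.smul_mk]
    refine ⟨φ, ?_, fun w hw => ?_, by rwa [hφ]⟩
    · refine (totalDegree_add _ _).trans (max_le (by simp) ?_)
      refine totalDegree_finsetSum_le fun i _ => (totalDegree_mul _ _).trans ?_
      simp
    · rw [hφ]
      exact hker (Submodule.subset_span ⟨w, hw, rfl⟩)

open MvPolynomial in
/-- A polynomial vanishing on a convex hull vanishes on the affine span. -/
lemma eval_eq_zero_of_forall_convexHull {n : ℕ} {W : Finset (Fin n → ℝ)}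
    {f : MvPolynomial (Fin n) ℝ}
    (hf : ∀ y ∈ convexHull ℝ (W : Set (Fin n → ℝ)), eval y f = 0)
    {a : (Fin n → ℝ) → ℝ} (ha : ∑ w ∈ W, a w = 1) : eval (∑ w ∈ W, a w • w) f = 0 := by
  have hne : W.Nonempty := by
    by_contra h
    simp [Finset.not_nonempty_iff_eq_empty.mp h] at ha
  have hcard : (0 : ℝ) < W.card := by exact_mod_cast hne.card_pos
  let b : ℝ := (W.card : ℝ)⁻¹
  have hb : 0 < b := inv_pos.mpr hcard
  have hbsum : ∑ w ∈ W, b = 1 := by simp [b, hcard.ne']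
  let P : Fin n → Polynomial ℝ :=
    fun i => ∑ w ∈ W, (Polynomial.C b + Polynomial.X * Polynomial.C (a w - b)) * Polynomial.C (w i)
  have hP : ∀ t : ℝ, (aeval P f).eval t = eval (∑ w ∈ W, (b + t * (a w - b)) • w) f := by
    intro t
    have : (Polynomial.evalRingHom t).comp (aeval P : MvPolynomial (Fin n) ℝ →ₐ[ℝ] _).toRingHom
        = eval (∑ w ∈ W, (b + t * (a w - b)) • w) := by
      ext i
      · simp
      · simp [P, Polynomial.eval_finsetSum, Finset.sum_apply]
    exact DFunLike.congr_fun this f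
  have hzero : aeval P f = 0 := by
    obtain ⟨ε, hε, hεW⟩ : ∃ ε > 0, ∀ t ∈ Set.Ioo (0 : ℝ) ε, ∀ w ∈ W, 0 ≤ b + t * (a w - b) := by
      have hev : ∀ᶠ t in nhds (0 : ℝ), ∀ w ∈ W, 0 < b + t * (a w - b) := by
        rw [Filter.eventually_all_finset]
        intro w _
        have hc : Continuous fun t : ℝ => b + t * (a w - b) := by fun_prop
        exact hc.continuousAt.eventually_const_lt
          (by simpa using hb)
      obtain ⟨ε, hε, h⟩ := Metric.eventually_nhds_iff.mp hev
      refine ⟨ε, hε, fun t ht w hw => (h ?_ w hw).le⟩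
      simpa [abs_of_pos ht.1] using ht.2
    refine Polynomial.eq_zero_of_infinite_isRoot _ ((Set.Ioo_infinite hε).mono fun t ht => ?_)
    change (aeval P f).eval t = 0
    rw [hP]
    refine hf _ (Finset.mem_convexHull'.mpr ⟨_, hεW t ht, ?_, rfl⟩)
    rw [Finset.sum_add_distrib, ← Finset.mul_sum, Finset.sum_sub_distrib, ha, hbsum]
    ring
  have h1 := hP 1
  rw [hzero] at h1
  simpa using h1.symm

/-- for an order ideal `I` of `ℝ[K]`, the set `Z(I) ∩ K` is Zariski
dense in the real zero set `Z(I)`. -/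
theorem zeroSet_inter_polytope_zariskiDense
    (n : ℕ) (hn : 1 ≤ n) (K : Set (Fin n → ℝ))
    (hKpoly : ∃ S : Finset (Fin n → ℝ), K = convexHull ℝ (↑S : Set (Fin n → ℝ)))
    (hKint : (interior K).Nonempty)
    (I : AddSubgroup (MvPolynomial (Fin n) ℝ)) (hI : ConeOrderIdeal K I) :
    ∀ f : MvPolynomial (Fin n) ℝ,
      (∀ x ∈ {x : Fin n → ℝ | ∀ g ∈ I, MvPolynomial.eval x g = 0} ∩ K,
        MvPolynomial.eval x f = 0) →
      ∀ x ∈ {x : Fin n → ℝ | ∀ g ∈ I, MvPolynomial.eval x g = 0},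
        MvPolynomial.eval x f = 0 := by
  classical
  obtain ⟨S, rfl⟩ := hKpoly
  intro f hf x hx
  obtain ⟨T, hTx, hIT, hconv, hprime, hTcone⟩ :=
    hI.exists_prime (fun _ hp => hp.exists_nat_sub) hx
  let W := S.filter fun v => ∀ l ∈ T, l.totalDegree ≤ 1 → MvPolynomial.eval v l = 0
  have hWS : W ⊆ S := Finset.filter_subset _ _
  rcases exists_affine_combination_or_separating W x with ⟨a, ha, rfl⟩ | ⟨φ, hφdeg, hφW, hφx⟩
  · refine eval_eq_zero_of_forall_convexHull (fun y hy => hf y ⟨fun g hg => ?_, ?_⟩) ha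
    · have hT : ∀ g, PolyCone (convexHull ℝ (S : Set (Fin n → ℝ))) g → g ∈ T →
          MvPolynomial.eval y g = 0 := by
        intro g hg
        induction hg with
        | const c hc => intro h; simpa using hTx _ h
        | lin p hdeg _ =>
          intro h
          obtain ⟨w, _, hw1, rfl⟩ := Finset.mem_convexHull'.mp hy
          rw [eval_sum_smul_of_totalDegree_le_one hdeg W w hw1]
          exact Finset.sum_eq_zero fun v hv => by
            rw [(Finset.mem_filter.mp hv).2 p h hdeg, mul_zero]
        | @add p q hp hq ihp ihq =>
          intro h
          rw [map_add, ihp (hconv p _ hp (by simpa using hq) h),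
            ihq (hconv q _ hq (by simpa using hp) h), add_zero]
        | @mul p q hp hq ihp ihq =>
          intro h
          rw [map_mul]
          rcases hprime p q hp hq h with h | h
          · rw [ihp h, zero_mul]
          · rw [ihq h, mul_zero]
      obtain ⟨p, q, hpI, hp, hqI, hq, rfl⟩ := hI.2 g hg
      rw [map_sub, hT p hp (hIT p hpI hp), hT q hq (hIT q hqI hq), sub_zero]
    · exact convexHull_mono (by exact_mod_cast hWS) hy
  · exfalso
    have hchoice : ∀ v, ∃ l ∈ T, l.totalDegree ≤ 1 ∧
        (v ∈ S \ W → MvPolynomial.eval v l ≠ 0) := by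
      intro v
      by_cases hv : v ∈ S \ W
      · obtain ⟨hvS, hvW⟩ := Finset.mem_sdiff.mp hv
        have : ¬∀ l ∈ T, l.totalDegree ≤ 1 → MvPolynomial.eval v l = 0 :=
          fun h => hvW (Finset.mem_filter.mpr ⟨hvS, h⟩)
        push Not at this
        obtain ⟨l, hl, hdeg, hne⟩ := this
        exact ⟨l, hl, hdeg, fun _ => hne⟩
      · exact ⟨0, T.zero_mem, by simp, fun h => absurd h hv⟩
    choose l hlT hldeg hlne using hchoice
    have hlnonneg : ∀ u, ∀ v ∈ S, 0 ≤ MvPolynomial.eval v (l u) := fun u v hv =>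
      (hTcone _ (hlT u)).eval_nonneg (subset_convexHull ℝ _ hv)
    let σ := ∑ u ∈ S \ W, l u
    have hσT : σ ∈ T := T.sum_mem fun u _ => hlT u
    have hσdeg : σ.totalDegree ≤ 1 := MvPolynomial.totalDegree_finsetSum_le fun u _ => hldeg u
    have hσpos : ∀ v ∈ S \ W, 0 < MvPolynomial.eval v σ := by
      intro v hv
      have hvS := (Finset.mem_sdiff.mp hv).1
      rw [map_sum]
      exact Finset.sum_pos' (fun u _ => hlnonneg u v hvS)
        ⟨v, hv, (hlnonneg v v hvS).lt_of_ne' (hlne v hv)⟩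
    obtain ⟨N, hN⟩ := exists_nat_ge
      (∑ v ∈ S \ W, |MvPolynomial.eval v φ| / MvPolynomial.eval v σ)
    have hbound : ∀ v ∈ S, |MvPolynomial.eval v φ| ≤ N * MvPolynomial.eval v σ := by
      intro v hv
      by_cases hvW : v ∈ W
      · rw [hφW v hvW, (Finset.mem_filter.mp hvW).2 σ hσT hσdeg]
        simp
      · have hv' : v ∈ S \ W := Finset.mem_sdiff.mpr ⟨hv, hvW⟩
        rw [← div_le_iff₀ (hσpos v hv')]
        refine le_trans ?_ hN
        exact Finset.single_le_sum
          (f := fun v => |MvPolynomial.eval v φ| / MvPolynomial.eval v σ)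
          (fun u hu => div_nonneg (abs_nonneg _) (hσpos u hu).le) hv'
    have hNdeg : (N • σ).totalDegree ≤ 1 := (MvPolynomial.totalDegree_smul_le _ _).trans hσdeg
    have hmem : N • σ + φ ∈ T := by
      refine hconv _ (N • σ + N • σ) ?_ ?_ (T.add_mem (T.nsmul_mem hσT N) (T.nsmul_mem hσT N))
      · refine .lin_of_forall_vertex
          ((MvPolynomial.totalDegree_add _ _).trans (max_le hNdeg hφdeg)) fun v hv => ?_
        have := neg_abs_le (MvPolynomial.eval v φ)
        have := hbound v hv
        rw [map_add, map_nsmul, nsmul_eq_mul]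
        linarith
      · rw [add_sub_add_left_eq_sub]
        refine .lin_of_forall_vertex
          ((MvPolynomial.totalDegree_sub _ _).trans (max_le hNdeg hφdeg)) fun v hv => ?_
        have := le_abs_self (MvPolynomial.eval v φ)
        have := hbound v hv
        rw [map_sub, map_nsmul, nsmul_eq_mul]
        linarith
    have := hTx _ hmem
    rw [map_add, map_nsmul, hTx σ hσT, smul_zero, zero_add] at this
    exact hφx this
end

section
/- In the polynomial ring ℝ[x,y], let α = 1 − (x + 3/5)² − (y + 3/5)², and let C be the smallest subset of ℝ[x,y] containing every nonnegative real constant together with x, y, and α, and closed under addition and multiplication. Then: (i) the polynomial u = y + 7/5 is an order unit for C (for every g there is a positive integer M with M·u − g ∈ C and M·u + g ∈ C); (ii) u·(1/5 − y) ∈ C (indeed (1/5 − y)(y + 7/5) = α + x² + (6/5)x); but (iii) 1/5 − y ∉ C. In particular, the partially ordered ring (ℝ[x,y], C) does not satisfy order unit cancellation. -/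
open MvPolynomial

/-- The positive cone on `ℝ[x,y]` generated (under addition and multiplication)
by the nonnegative constants, `x`, `y`, and `α = 1 − (x+3/5)² − (y+3/5)²`. -/
inductive DiskCone : MvPolynomial (Fin 2) ℝ → Prop
  | const (c : ℝ) (hc : 0 ≤ c) : DiskCone (MvPolynomial.C c)
  | x : DiskCone (MvPolynomial.X 0)
  | y : DiskCone (MvPolynomial.X 1)
  | alpha : DiskCone (1 - (MvPolynomial.X 0 + MvPolynomial.C ((3 : ℝ)/5)) ^ 2
      - (MvPolynomial.X 1 + MvPolynomial.C ((3 : ℝ)/5)) ^ 2)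
  | add {p q : MvPolynomial (Fin 2) ℝ} : DiskCone p → DiskCone q → DiskCone (p + q)
  | mul {p q : MvPolynomial (Fin 2) ℝ} : DiskCone p → DiskCone q → DiskCone (p * q)

namespace DiskCone

/-- Rewriting the membership predicate along an equality of polynomial functions. -/
theorem of_eval_eq {p q : MvPolynomial (Fin 2) ℝ} (hp : DiskCone p)
    (h : ∀ v : Fin 2 → ℝ, eval v p = eval v q) : DiskCone q :=
  MvPolynomial.funext h ▸ hp

/-- Every polynomial is bounded by a real constant with respect to the cone. -/
theorem exists_const_bound (g : MvPolynomial (Fin 2) ℝ) :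
    ∃ m : ℝ, DiskCone (C m - g) ∧ DiskCone (C m + g) := by
  induction g using MvPolynomial.induction_on with
  | C a =>
    refine ⟨|a|, ?_, ?_⟩
    · rw [← C_sub]
      exact const _ (sub_nonneg.2 (le_abs_self a))
    · rw [← C_add]
      exact const _ (by linarith [neg_abs_le a])
  | add p q hp hq =>
    obtain ⟨m, hp₁, hp₂⟩ := hp
    obtain ⟨n, hq₁, hq₂⟩ := hq
    refine ⟨m + n, (hp₁.add hq₁).of_eval_eq fun v => ?_, (hp₂.add hq₂).of_eval_eq fun v => ?_⟩ <;>
    · simp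
      ring
  | mul_X p i hp =>
    obtain ⟨m, hp₁, hp₂⟩ := hp
    have hX : ∃ n : ℝ, DiskCone (C n - X i) ∧ DiskCone (C n + X i) := by
      have h₀ : DiskCone (C (5 / 6)) := const _ (by norm_num)
      have h₁ : DiskCone (C (6 / 5)) := const _ (by norm_num)
      have h₂ : DiskCone (C (7 / 30)) := const _ (by norm_num)
      have hsq := (alpha.add (x.mul x)).add (y.mul y)
      fin_cases i
      · refine ⟨7 / 30, (h₀.mul (hsq.add (h₁.mul y))).of_eval_eq fun v => ?_, h₂.add x⟩
        simp
        ring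
      · refine ⟨7 / 30, (h₀.mul (hsq.add (h₁.mul x))).of_eval_eq fun v => ?_, h₂.add y⟩
        simp
        ring
    obtain ⟨n, hX₁, hX₂⟩ := hX
    have h_half : DiskCone (C (1 / 2)) := const _ (by norm_num)
    refine ⟨m * n,
      (h_half.mul ((hp₁.mul hX₂).add (hp₂.mul hX₁))).of_eval_eq fun v => ?_,
      (h_half.mul ((hp₁.mul hX₁).add (hp₂.mul hX₂))).of_eval_eq fun v => ?_⟩ <;>
    · simp
      ring

theorem orderUnit (g : MvPolynomial (Fin 2) ℝ) : ∃ M : ℕ, 0 < M ∧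
    DiskCone (M • (X 1 + C ((7 : ℝ) / 5)) - g) ∧ DiskCone (M • (X 1 + C ((7 : ℝ) / 5)) + g) := by
  obtain ⟨m, h₁, h₂⟩ := exists_const_bound g
  obtain ⟨M, hM⟩ := exists_nat_gt (max m 0)
  obtain ⟨hm, hM₀⟩ := max_lt_iff.1 hM
  have hy : DiskCone (C (M : ℝ) * X 1 + C (M * (7 / 5) - m)) :=
    ((const _ hM₀.le).mul y).add (const _ (by linarith))
  refine ⟨M, by exact_mod_cast hM₀, (hy.add h₁).of_eval_eq fun v => ?_,
    (hy.add h₂).of_eval_eq fun v => ?_⟩ <;>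
  · simp
    ring

theorem orderUnit_mul_mem :
    DiskCone ((X 1 + C ((7 : ℝ) / 5)) * (C ((1 : ℝ) / 5) - X 1)) := by
  have h : DiskCone (C (6 / 5)) := const _ (by norm_num)
  refine ((alpha.add (x.mul x)).add (h.mul x)).of_eval_eq fun v => ?_
  simp
  ring

/-- The disk and the line `x = 0` meet in the boundary points `(0, 1/5)` and `(0, -7/5)`.
An element of the cone is nonnegative at the first, and vanishes at the second as soon as it
vanishes at the first. -/
theorem eval_boundary {p : MvPolynomial (Fin 2) ℝ} (hp : DiskCone p) :
    0 ≤ eval ![0, 1 / 5] p ∧ (eval ![0, 1 / 5] p = 0 → eval ![0, -(7 / 5)] p = 0) := by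
  induction hp with
  | const c hc => simpa using hc
  | x => simp
  | y => simp
  | alpha => norm_num
  | add _ _ hp hq =>
    simp only [map_add]
    refine ⟨add_nonneg hp.1 hq.1, fun h => ?_⟩
    obtain ⟨h₁, h₂⟩ := (add_eq_zero_iff_of_nonneg hp.1 hq.1).1 h
    rw [hp.2 h₁, hq.2 h₂, add_zero]
  | mul _ _ hp hq =>
    simp only [map_mul]
    exact ⟨mul_nonneg hp.1 hq.1, fun h => mul_eq_zero.2 ((mul_eq_zero.1 h).imp hp.2 hq.2)⟩

theorem not_mem : ¬ DiskCone (C ((1 : ℝ) / 5) - X 1) := fun h => by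
  have := h.eval_boundary.2 (by simp)
  norm_num at this

end DiskCone

/-- `u = y + 7/5` is an order unit for `DiskCone`,
`u·(1/5 − y) ∈ DiskCone`, but `1/5 − y ∉ DiskCone`; in particular
`(ℝ[x,y], DiskCone)` does not satisfy order unit cancellation. -/
theorem diskCone_not_orderUnitCancellation :
    (∀ g : MvPolynomial (Fin 2) ℝ, ∃ M : ℕ, 0 < M ∧
      DiskCone (M • (MvPolynomial.X 1 + MvPolynomial.C ((7 : ℝ)/5)) - g) ∧
      DiskCone (M • (MvPolynomial.X 1 + MvPolynomial.C ((7 : ℝ)/5)) + g)) ∧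
    DiskCone ((MvPolynomial.X 1 + MvPolynomial.C ((7 : ℝ)/5)) *
      (MvPolynomial.C ((1 : ℝ)/5) - MvPolynomial.X 1)) ∧
    ¬ DiskCone (MvPolynomial.C ((1 : ℝ)/5) - MvPolynomial.X 1) ∧
    ¬ (∀ u a : MvPolynomial (Fin 2) ℝ,
        (∀ g : MvPolynomial (Fin 2) ℝ, ∃ M : ℕ, 0 < M ∧
          DiskCone (M • u - g) ∧ DiskCone (M • u + g)) →
        u ≠ 0 → DiskCone (u * a) → DiskCone a) := by
  refine ⟨DiskCone.orderUnit, DiskCone.orderUnit_mul_mem, DiskCone.not_mem, fun h => ?_⟩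
  refine DiskCone.not_mem (h _ _ DiskCone.orderUnit (fun h₀ => ?_) DiskCone.orderUnit_mul_mem)
  simpa using congrArg (eval 0) h₀
end

section
/- Let R = ℝ[x] be the real polynomial ring in one variable, equipped with the positive cone R₁⁺ = {0} ∪ {x^j·(1+x)·f : j ≥ 1, f(t) > 0 for all t ∈ [0,1]} ∪ {f : f(t) > 0 for all t ∈ [0,1]}. Then: (i) 1 + x is an order unit for R₁⁺ (for every g ∈ R there is a positive integer M with M·(1+x) − g ∈ R₁⁺ and M·(1+x) + g ∈ R₁⁺); (ii) x·(1+x) ∈ R₁⁺; but (iii) x ∉ R₁⁺. In particular, (ℝ[x], R₁⁺) does not satisfy order unit cancellation. -/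
/-- The positive cone `R₁⁺` on `ℝ[x]`:
`{0} ∪ {x^j·(1+x)·f : j ≥ 1, f > 0 on [0,1]} ∪ {f : f > 0 on [0,1]}`. -/
def pos1 : Set (Polynomial ℝ) :=
  {0} ∪
  {g | ∃ (j : ℕ) (f : Polynomial ℝ), 1 ≤ j ∧
    (∀ t ∈ Set.Icc (0 : ℝ) 1, 0 < f.eval t) ∧
    g = Polynomial.X ^ j * ((1 + Polynomial.X) * f)} ∪
  {f | ∀ t ∈ Set.Icc (0 : ℝ) 1, 0 < f.eval t}

open Polynomial in
theorem mem_pos1_of_eval_pos {f : ℝ[X]} (hf : ∀ t ∈ Set.Icc (0 : ℝ) 1, 0 < f.eval t) :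
    f ∈ pos1 :=
  Or.inr hf

open Polynomial in
theorem isOrderUnit_one_add_X (g : ℝ[X]) :
    ∃ M : ℕ, 0 < M ∧ M • (1 + X) - g ∈ pos1 ∧ M • (1 + X) + g ∈ pos1 := by
  obtain ⟨C, hC⟩ := isCompact_Icc.exists_bound_of_continuousOn
    (g.continuous.continuousOn (s := Set.Icc (0 : ℝ) 1))
  obtain ⟨n, hn⟩ := exists_nat_gt C
  have bound : ∀ t ∈ Set.Icc (0 : ℝ) 1, |g.eval t| < ((n + 1 : ℕ) : ℝ) * (1 + t) := by
    intro t ht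
    have h := hC t ht
    rw [Real.norm_eq_abs] at h
    have h_nonneg : 0 ≤ ((n + 1 : ℕ) : ℝ) * t := mul_nonneg (Nat.cast_nonneg _) ht.1
    push_cast at h_nonneg ⊢
    linarith
  refine ⟨n + 1, n.succ_pos, mem_pos1_of_eval_pos fun t ht => ?_,
    mem_pos1_of_eval_pos fun t ht => ?_⟩
  all_goals
    have h := abs_lt.mp (bound t ht)
    simp only [nsmul_eq_mul, eval_sub, eval_add, eval_mul, eval_natCast, eval_one, eval_X]
    linarith [h.1, h.2]

open Polynomial in
theorem X_mul_one_add_X_mem_pos1 : (X * (1 + X) : ℝ[X]) ∈ pos1 :=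
  Or.inl (Or.inr ⟨1, 1, le_rfl, by simp, by simp⟩)

open Polynomial in
theorem X_notMem_pos1 : (X : ℝ[X]) ∉ pos1 := by
  rintro ((h | ⟨j, f, -, -, h⟩) | h)
  · exact X_ne_zero h
  · simpa using congrArg (eval (-1)) h
  · simpa using h 0 (by simp)

/-- in `(ℝ[x], R₁⁺)`, `1 + x` is an order unit, `x·(1+x) ∈ R₁⁺`,
but `x ∉ R₁⁺`; in particular order unit cancellation fails. -/
theorem pos1_not_orderUnitCancellation :
    (∀ g : Polynomial ℝ, ∃ M : ℕ, 0 < M ∧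
      M • (1 + Polynomial.X) - g ∈ pos1 ∧ M • (1 + Polynomial.X) + g ∈ pos1) ∧
    Polynomial.X * (1 + Polynomial.X) ∈ pos1 ∧
    Polynomial.X ∉ pos1 ∧
    ¬ (∀ u a : Polynomial ℝ,
        (∀ g : Polynomial ℝ, ∃ M : ℕ, 0 < M ∧ M • u - g ∈ pos1 ∧ M • u + g ∈ pos1) →
        u ≠ 0 → u * a ∈ pos1 → a ∈ pos1) := by
  refine ⟨isOrderUnit_one_add_X, X_mul_one_add_X_mem_pos1, X_notMem_pos1, fun h => ?_⟩
  refine X_notMem_pos1 (h (1 + Polynomial.X) Polynomial.X isOrderUnit_one_add_X ?_ ?_)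
  · intro h_zero
    simpa using congrArg (Polynomial.eval 0) h_zero
  · rw [mul_comm]
    exact X_mul_one_add_X_mem_pos1
end
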